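/- Fix purely imaginary parameters τ, τ' ∈ iℝ and set 𝒮 = 2(|τ| + |τ'|) + 1. Then there exists a constant C > 0, depending only on τ and τ', such that for every even integer n ≥ 0 and every λ = i·t with real t satisfying 𝒮 ≤ t < 4n, there is a complex number A(λ, n), independent of the test function, with |A(λ, n)| ≤ C · t^{−5/6}, such that for every smooth π-periodic function φ : ℝ → ℂ, |F_{λ,n}(φ) − A(λ, n) · φ(π/2)| ≤ C · ‖φ‖_{C²} · t^{−1/2} · (1 + n)^{−1/2} + C · ‖φ‖_{C³} · t^{−3/2}. -/

import Mathlib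

open MeasureTheory Real

/-- `pw r z = r^z = exp(z · ln r)` for a real base `r > 0`. -/
noncomputable def pw (r : ℝ) (z : ℂ) : ℂ := Complex.exp (z * (Real.log r : ℂ))

/-- The kernel `K_{τ,τ',λ}(x,y,z)` of the model trilinear functional. -/
noncomputable def Kker (τ τ' lam : ℂ) (x y z : ℝ) : ℂ :=
  pw |Real.sin (x - y)| ((-τ - τ' + lam - 1) / 2) *
    pw |Real.sin (x - z)| ((-τ + τ' - lam - 1) / 2) *
    pw |Real.sin (y - z)| ((τ - τ' - lam - 1) / 2)

/-- `l_λ(c) = (1/2π) ∫₀^{2π} K_{τ,τ',λ}(y+c, y, 0) dy`. -/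
noncomputable def lker (τ τ' lam : ℂ) (c : ℝ) : ℂ :=
  (1 / (2 * (π : ℂ))) * ∫ y in (0 : ℝ)..(2 * π), Kker τ τ' lam (y + c) y 0

/-- `F_{λ,n}(φ) = ∫₀^{2π} l_λ(c) e^{inc} φ(c) dc`. -/
noncomputable def Ffun (τ τ' lam : ℂ) (n : ℤ) (φ : ℝ → ℂ) : ℂ :=
  ∫ c in (0 : ℝ)..(2 * π),
    lker τ τ' lam c * Complex.exp (Complex.I * (n : ℂ) * (c : ℂ)) * φ c

/-- `k_λ(c) = |sin c|^{(-τ-τ'-1)/2} |sin(c/2)|^{-λ/2} |cos(c/2)|^{λ/2}`. -/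
noncomputable def kfun (τ τ' lam : ℂ) (c : ℝ) : ℂ :=
  pw |Real.sin c| ((-τ - τ' - 1) / 2) * pw |Real.sin (c / 2)| (-lam / 2) *
    pw |Real.cos (c / 2)| (lam / 2)

/-- `G_{λ,n}(φ) = 2 ∫₀^π k_λ(c) e^{inc} φ(c) dc`. -/
noncomputable def Gfun (τ τ' lam : ℂ) (n : ℤ) (φ : ℝ → ℂ) : ℂ :=
  2 * ∫ c in (0 : ℝ)..π,
    kfun τ τ' lam c * Complex.exp (Complex.I * (n : ℂ) * (c : ℂ)) * φ c

/-- Global `C^N`-norm of `φ`. -/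
noncomputable def Cnorm (N : ℕ) (φ : ℝ → ℂ) : ℝ :=
  ⨆ (m : Fin (N + 1)) (x : ℝ), ‖iteratedDeriv (m : ℕ) φ x‖

theorem integrable_abs_of_hasDerivAt_of_bounded {G g : ℝ → ℝ} {B σ₁ σ₂ : ℝ}
    (hG : ∀ x, HasDerivAt G (g x) x) (hg : Continuous g) (hB : ∀ x, |G x| ≤ B)
    (h₁ : ∀ x, 0 ≤ x → |g x| = σ₁ * g x) (h₂ : ∀ x, x ≤ 0 → |g x| = σ₂ * g x)
    (hσ₁ : |σ₁| ≤ 1) (hσ₂ : |σ₂| ≤ 1) :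
    Integrable (fun x => |g x|) ∧ ∫ x, |g x| ≤ 4 * B := by
  have key : ∀ i : ℝ, 0 ≤ i → ∫ x in (-i)..i, |g x| ≤ 4 * B := by
    intro i hi
    have hint : ∀ a b : ℝ, IntervalIntegrable (fun x => |g x|) volume a b :=
      fun a b => hg.abs.intervalIntegrable a b
    rw [← intervalIntegral.integral_add_adjacent_intervals (hint (-i) 0) (hint 0 i)]
    have e₁ : ∫ x in (0 : ℝ)..i, |g x| = σ₁ * (G i - G 0) := by
      rw [← intervalIntegral.integral_eq_sub_of_hasDerivAt (fun x _ => hG x)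
        (hg.intervalIntegrable _ _), ← intervalIntegral.integral_const_mul]
      refine intervalIntegral.integral_congr fun x hx => h₁ x ?_
      rw [Set.uIcc_of_le hi] at hx
      exact hx.1
    have e₂ : ∫ x in (-i)..(0 : ℝ), |g x| = σ₂ * (G 0 - G (-i)) := by
      rw [← intervalIntegral.integral_eq_sub_of_hasDerivAt (fun x _ => hG x)
        (hg.intervalIntegrable _ _), ← intervalIntegral.integral_const_mul]
      refine intervalIntegral.integral_congr fun x hx => h₂ x ?_
      rw [Set.uIcc_of_le (by linarith)] at hx
      exact hx.2
    have bd : ∀ σ a b : ℝ, |σ| ≤ 1 → σ * (G a - G b) ≤ 2 * B := by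
      intro σ a b hσ
      have h1 : |G a - G b| ≤ 2 * B := by
        have := abs_sub (G a) (G b)
        linarith [hB a, hB b]
      calc σ * (G a - G b) ≤ |σ * (G a - G b)| := le_abs_self _
        _ = |σ| * |G a - G b| := abs_mul _ _
        _ ≤ 1 * (2 * B) := mul_le_mul hσ h1 (abs_nonneg _) zero_le_one
        _ = 2 * B := one_mul _
    rw [e₁, e₂]
    linarith [bd σ₁ i 0 hσ₁, bd σ₂ 0 (-i) hσ₂]
  have hI : Integrable (fun x => |g x|) := by
    refine integrable_of_intervalIntegral_norm_bounded (l := Filter.atTop) (a := fun i : ℝ => -i)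
      (b := fun i : ℝ => i) (4 * B) (fun i => ?_) Filter.tendsto_neg_atTop_atBot Filter.tendsto_id ?_
    · exact (hg.abs.integrableOn_Icc).mono_set Set.Ioc_subset_Icc_self
    · filter_upwards [Filter.eventually_ge_atTop (0 : ℝ)] with i hi
      simpa using key i hi
  refine ⟨hI, ?_⟩
  refine le_of_tendsto (intervalIntegral_tendsto_integral hI Filter.tendsto_neg_atTop_atBot
    Filter.tendsto_id) ?_
  filter_upwards [Filter.eventually_ge_atTop (0 : ℝ)] with i hi
  exact key i hi

theorem norm_integral_exp_mul_le {Ψ Ψ' q q' D : ℝ → ℝ} {b b' : ℝ → ℂ} {M : ℝ}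
    (hΨ : ∀ x, HasDerivAt Ψ (Ψ' x) x) (hq : ∀ x, HasDerivAt q (q' x) x)
    (hb : ∀ x, HasDerivAt b (b' x) x) (hbi : Integrable b) (hM : ∀ x, |q x| ≤ M)
    (hD : Integrable D)
    (hle : ∀ x, ‖b x‖ * |1 - Ψ' x * q x| + ‖b' x‖ * |q x| + ‖b x‖ * |q' x| ≤ D x) :
    ‖∫ x, Complex.exp (Complex.I * (Ψ x : ℂ)) * b x‖ ≤ ∫ x, D x := by
  have cΨ : Continuous Ψ := continuous_iff_continuousAt.2 fun x => (hΨ x).continuousAt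
  have cq : Continuous q := continuous_iff_continuousAt.2 fun x => (hq x).continuousAt
  have cb : Continuous b := continuous_iff_continuousAt.2 fun x => (hb x).continuousAt
  have mΨ' : Measurable Ψ' := by
    have : Ψ' = deriv Ψ := funext fun x => (hΨ x).deriv.symm
    rw [this]; exact measurable_deriv _
  have mq' : Measurable q' := by
    have : q' = deriv q := funext fun x => (hq x).deriv.symm
    rw [this]; exact measurable_deriv _
  have mb' : Measurable b' := by
    have : b' = deriv b := funext fun x => (hb x).deriv.symm
    rw [this]; exact measurable_deriv _
  set e : ℝ → ℂ := fun x => Complex.exp (Complex.I * (Ψ x : ℂ)) with he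
  have ce : Continuous e := by fun_prop
  have ne : ∀ x, ‖e x‖ = 1 := by
    intro x
    rw [he]
    simp only [Complex.norm_exp]
    simp
  have he' : ∀ x, HasDerivAt e (e x * (Complex.I * (Ψ' x : ℂ))) x := fun x =>
    ((hΨ x).ofReal_comp.const_mul Complex.I).cexp
  set f : ℝ → ℂ := fun x => e x * (b x * (q x : ℂ)) with hf
  set R : ℝ → ℂ := fun x => e x * (b' x * (q x : ℂ) + b x * (q' x : ℂ)) with hR
  set S : ℝ → ℂ := fun x => e x * (b x * ((1 - Ψ' x * q x : ℝ) : ℂ)) with hS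
  have hf' : ∀ x, HasDerivAt f
      (e x * (Complex.I * (Ψ' x : ℂ)) * (b x * (q x : ℂ)) +
        e x * (b' x * (q x : ℂ) + b x * (q' x : ℂ))) x := fun x =>
    (he' x).mul ((hb x).mul (hq x).ofReal_comp)
  have hDn : ∀ x, 0 ≤ D x := fun x => le_trans (by positivity) (hle x)
  have nR : ∀ x, ‖R x‖ ≤ ‖b' x‖ * |q x| + ‖b x‖ * |q' x| := by
    intro x
    rw [hR]
    simp only [norm_mul, ne, one_mul]
    refine (norm_add_le _ _).trans ?_
    simp
  have nS : ∀ x, ‖S x‖ = ‖b x‖ * |1 - Ψ' x * q x| := by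
    intro x
    rw [hS]
    simp only [norm_mul, ne, one_mul, Complex.norm_real, Real.norm_eq_abs]
  have iR : Integrable R := by
    refine hD.mono' ?_ (Filter.Eventually.of_forall fun x => ?_)
    · exact (ce.measurable.mul ((mb'.mul (Complex.measurable_ofReal.comp cq.measurable)).add
        (cb.measurable.mul (Complex.measurable_ofReal.comp mq')))).aestronglyMeasurable
    · have := hle x
      have h0 : 0 ≤ ‖b x‖ * |1 - Ψ' x * q x| := by positivity
      linarith [nR x]
  have iS : Integrable S := by
    refine hD.mono' ?_ (Filter.Eventually.of_forall fun x => ?_)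
    · exact (ce.measurable.mul (cb.measurable.mul (Complex.measurable_ofReal.comp
        (measurable_const.sub (mΨ'.mul cq.measurable))))).aestronglyMeasurable
    · have := hle x
      have h0 : 0 ≤ ‖b' x‖ * |q x| + ‖b x‖ * |q' x| := by positivity
      linarith [nS x]
  have ib : Integrable (fun x => e x * b x) := by
    refine hbi.norm.mono' (ce.mul cb).aestronglyMeasurable
      (Filter.Eventually.of_forall fun x => ?_)
    simp [ne]
  have iff' : Integrable f := by
    refine (hbi.norm.const_mul M).mono' ?_ (Filter.Eventually.of_forall fun x => ?_)
    · exact (ce.mul (cb.mul (Complex.continuous_ofReal.comp cq))).aestronglyMeasurable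
    · rw [hf]
      simp only [norm_mul, ne, one_mul, Complex.norm_real, Real.norm_eq_abs]
      rw [mul_comm]
      exact mul_le_mul_of_nonneg_right (hM x) (norm_nonneg _)
  have dec : ∀ x, e x * (Complex.I * (Ψ' x : ℂ)) * (b x * (q x : ℂ)) +
      e x * (b' x * (q x : ℂ) + b x * (q' x : ℂ)) =
      Complex.I * (e x * b x) - Complex.I * S x + R x := by
    intro x
    simp only [hS, hR]
    push_cast
    ring
  have i' : Integrable (fun x => e x * (Complex.I * (Ψ' x : ℂ)) * (b x * (q x : ℂ)) +
      e x * (b' x * (q x : ℂ) + b x * (q' x : ℂ))) := by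
    simp_rw [dec]
    exact ((ib.const_mul _).sub (iS.const_mul _)).add iR
  have z := integral_eq_zero_of_hasDerivAt_of_integrable hf' i' iff'
  simp_rw [dec] at z
  have i₁ : Integrable (fun x => Complex.I * (e x * b x) - Complex.I * S x) :=
    (ib.const_mul _).sub (iS.const_mul _)
  rw [integral_add i₁ iR, integral_sub (ib.const_mul _) (iS.const_mul _), integral_const_mul, integral_const_mul] at z
  have z2 : ∫ x, e x * b x = ∫ x, (S x + Complex.I * R x) := by
    rw [integral_add iS (iR.const_mul _), integral_const_mul]
    linear_combination (-Complex.I) * z + ((∫ x, e x * b x) - ∫ x, S x) * Complex.I_sq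
  rw [z2]
  refine norm_integral_le_of_norm_le hD (Filter.Eventually.of_forall fun x => ?_)
  refine (norm_add_le _ _).trans ?_
  have hI : ‖Complex.I * R x‖ = ‖R x‖ := by rw [norm_mul, Complex.norm_I, one_mul]
  rw [hI, nS]
  linarith [nR x, hle x]

theorem integrable_mul_cosh_div_one_add_sq (s : ℝ) (hs : 0 < s) :
    Integrable (fun x => |s * cosh x / (1 + (s * sinh x) ^ 2)|) ∧
      ∫ x, |s * cosh x / (1 + (s * sinh x) ^ 2)| ≤ 2 * π := by
  have h := integrable_abs_of_hasDerivAt_of_bounded (G := fun x => arctan (s * sinh x))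
    (g := fun x => s * cosh x / (1 + (s * sinh x) ^ 2)) (B := π / 2) (σ₁ := 1) (σ₂ := 1)
    (fun x => ?_) ?_ (fun x => ?_) (fun x _ => ?_) (fun x _ => ?_) (by simp) (by simp)
  · exact ⟨h.1, h.2.trans_eq (by ring)⟩
  · refine (((hasDerivAt_sinh x).const_mul s).arctan).congr_deriv ?_
    ring
  · exact Continuous.div (by fun_prop) (by fun_prop) fun x => by positivity
  · exact abs_le.2 ⟨(neg_pi_div_two_lt_arctan _).le, (arctan_lt_pi_div_two _).le⟩
  · rw [one_mul, abs_of_nonneg]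
    have := cosh_pos x
    positivity
  · rw [one_mul, abs_of_nonneg]
    have := cosh_pos x
    positivity

theorem integrable_inv_cosh : Integrable (fun x : ℝ => (cosh x)⁻¹) := by
  refine (integrable_mul_cosh_div_one_add_sq 1 one_pos).1.congr
    (Filter.Eventually.of_forall fun x => ?_)
  have h := cosh_sq x
  have hc := cosh_pos x
  have : (1 : ℝ) + (1 * sinh x) ^ 2 = cosh x ^ 2 := by rw [one_mul, h]; ring
  simp only [this]
  simp only [one_mul]
  rw [abs_of_nonneg (by positivity)]
  field_simp

theorem integrable_inv_one_add_mul_sq {t : ℝ} (ht : 0 < t) :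
    Integrable (fun x => |(1 + t * x ^ 2)⁻¹|) ∧
      ∫ x, |(1 + t * x ^ 2)⁻¹| ≤ 2 * π / √t := by
  have hst : 0 < √t := sqrt_pos.2 ht
  have h := integrable_abs_of_hasDerivAt_of_bounded (G := fun x => arctan (√t * x) / √t)
    (g := fun x => (1 + t * x ^ 2)⁻¹) (B := π / 2 / √t) (σ₁ := 1) (σ₂ := 1)
    (fun x => ?_) ?_ (fun x => ?_) (fun x _ => ?_) (fun x _ => ?_) (by simp) (by simp)
  · exact ⟨h.1, h.2.trans_eq (by ring)⟩
  · refine ((((hasDerivAt_id x).const_mul (√t)).arctan).div_const (√t)).congr_deriv ?_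
    have : (√t * x) ^ 2 = t * x ^ 2 := by rw [mul_pow, sq_sqrt ht.le]
    simp only [id, this]
    field_simp
  · exact Continuous.inv₀ (by fun_prop) fun x => by positivity
  · rw [abs_div, abs_of_pos hst]
    gcongr
    exact abs_le.2 ⟨(neg_pi_div_two_lt_arctan _).le, (arctan_lt_pi_div_two _).le⟩
  · rw [one_mul, abs_of_nonneg (by positivity)]
  · rw [one_mul, abs_of_nonneg (by positivity)]

theorem abs_le_abs_sinh (x : ℝ) : |x| ≤ |sinh x| := by
  rcases le_total 0 x with h | h
  · rw [abs_of_nonneg h, abs_of_nonneg (sinh_nonneg_iff.2 h)]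
    exact self_le_sinh_iff.2 h
  · rw [abs_of_nonpos h, abs_of_nonpos (sinh_nonpos_iff.2 h)]
    exact neg_le_neg (sinh_le_self_iff.2 h)

theorem mul_cosh_le_sqrt {s : ℝ} (hs : 0 < s) (hs1 : s ≤ 1) (x : ℝ) :
    s * cosh x ≤ √(1 + (s * sinh x) ^ 2) := by
  refine le_sqrt_of_sq_le ?_
  rw [mul_pow, mul_pow, cosh_sq]
  nlinarith

/-- The oscillatory integral `∫ exp(i t log cosh ξ) g(s sinh ξ) dξ`. -/
noncomputable def coshOsc (t : ℝ) (g : ℝ → ℂ) (s : ℝ) : ℂ :=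
  ∫ ξ, Complex.exp (Complex.I * ((t * log (cosh ξ) : ℝ) : ℂ)) * g (s * sinh ξ)

theorem integrable_comp_mul_sinh {g : ℝ → ℂ} {K s : ℝ} (hgc : Continuous g)
    (hg : ∀ z, ‖g z‖ ≤ K / √(1 + z ^ 2)) (hs : 0 < s) (hs1 : s ≤ 1) :
    Integrable (fun x => g (s * sinh x)) := by
  have hK : 0 ≤ K := by simpa using (norm_nonneg _).trans (hg 0)
  refine (integrable_inv_cosh.const_mul (K / s)).mono' (by fun_prop)
    (Filter.Eventually.of_forall fun x => (hg _).trans ?_)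
  have hc := cosh_pos x
  have h1 := mul_cosh_le_sqrt hs hs1 x
  calc K / √(1 + (s * sinh x) ^ 2) ≤ K / (s * cosh x) := by gcongr
    _ = K / s * (cosh x)⁻¹ := by field_simp

theorem norm_coshOsc_le {g g' : ℝ → ℂ} {K s t : ℝ} (ht : 1 ≤ t) (hs : 0 < s) (hs1 : s ≤ 1)
    (hg' : ∀ z, HasDerivAt g (g' z) z) (hgK : ∀ z, ‖g z‖ ≤ K / √(1 + z ^ 2))
    (hg'K : ∀ z, ‖g' z‖ ≤ K / (1 + z ^ 2)) :
    ‖coshOsc t g s‖ ≤ 11 * π * K / √t := by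
  have hK : 0 ≤ K := by simpa using (norm_nonneg _).trans (hgK 0)
  have ht0 : 0 < t := by linarith
  have hst : 0 < √t := sqrt_pos.2 ht0
  have hst1 : 1 ≤ √t := one_le_sqrt.2 ht
  have hts : √t ^ 2 = t := sq_sqrt ht0.le
  have hgc : Continuous g := continuous_iff_continuousAt.2 fun x => (hg' x).continuousAt
  obtain ⟨i₁, b₁⟩ := integrable_mul_cosh_div_one_add_sq s hs
  obtain ⟨i₂, b₂⟩ := integrable_inv_one_add_mul_sq ht0
  have hden : ∀ x, 0 < t * sinh x ^ 2 + 1 := fun x => by positivity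
  have hqb : ∀ x, |sinh x * cosh x / (t * sinh x ^ 2 + 1)| ≤ 3 / 2 / √t := by
    intro x
    have hc := cosh_pos x
    rw [abs_div, abs_of_pos (hden x), abs_mul, abs_of_pos hc, div_le_div_iff₀ (hden x) hst]
    have h1 : cosh x ≤ 1 + |sinh x| := by
      have := cosh_sq x
      have h2 := sq_abs (sinh x)
      have h3 := abs_nonneg (sinh x)
      nlinarith
    set S := |sinh x| with hS
    have hS0 : 0 ≤ S := abs_nonneg _
    have h2 : sinh x ^ 2 = S ^ 2 := (sq_abs _).symm
    rw [h2]
    have h3 : S * cosh x * √t ≤ S * (1 + S) * √t := by gcongr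
    have h5 : √t ≤ t := by nlinarith
    have h4 : S ^ 2 * √t ≤ t * S ^ 2 := by
      rw [mul_comm]
      gcongr
    have h6 : 2 * (√t * S) ≤ t * S ^ 2 + 1 := by
      have h7 : (√t * S) ^ 2 = t * S ^ 2 := by rw [mul_pow, hts]
      nlinarith [sq_nonneg (√t * S - 1)]
    nlinarith
  have h := norm_integral_exp_mul_le (Ψ := fun x => t * log (cosh x))
    (Ψ' := fun x => t * (sinh x / cosh x))
    (q := fun x => sinh x * cosh x / (t * sinh x ^ 2 + 1))
    (q' := fun x => ((cosh x * cosh x + sinh x * sinh x) * (t * sinh x ^ 2 + 1) -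
      sinh x * cosh x * (t * (2 * sinh x * cosh x))) / (t * sinh x ^ 2 + 1) ^ 2)
    (b := fun x => g (s * sinh x)) (b' := fun x => (s * cosh x) • g' (s * sinh x))
    (D := fun x => 3 / 2 * K / √t * |s * cosh x / (1 + (s * sinh x) ^ 2)| +
      4 * K * |(1 + t * x ^ 2)⁻¹|)
    (M := 3 / 2 / √t) ?_ ?_ ?_ (integrable_comp_mul_sinh hgc hgK hs hs1) hqb
    ((i₁.const_mul _).add (i₂.const_mul _)) ?_
  · refine h.trans ?_
    rw [integral_add (i₁.const_mul _) (i₂.const_mul _), integral_const_mul, integral_const_mul]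
    calc _ ≤ 3 / 2 * K / √t * (2 * π) + 4 * K * (2 * π / √t) := by gcongr
      _ = 11 * π * K / √t := by ring
  · intro x
    exact ((hasDerivAt_cosh x).log (cosh_pos x).ne').const_mul t
  · intro x
    refine ((((hasDerivAt_sinh x).mul (hasDerivAt_cosh x)).div
      ((((hasDerivAt_sinh x).pow 2).const_mul t).add_const 1) (hden x).ne')).congr_deriv ?_
    simp
  · intro x
    exact (hg' _).scomp x ((hasDerivAt_sinh x).const_mul s)
  · intro x
    have hc := cosh_pos x
    have hb : ‖g (s * sinh x)‖ ≤ K := by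
      refine (hgK _).trans (div_le_self hK ?_)
      exact one_le_sqrt.2 (by nlinarith [sq_nonneg (s * sinh x)])
    have hxs : 1 + t * x ^ 2 ≤ t * sinh x ^ 2 + 1 := by
      have := sq_le_sq.2 (abs_le_abs_sinh x)
      nlinarith
    have hpos : 0 < 1 + t * x ^ 2 := by positivity
    have hcs := cosh_sq x
    have e1 : |1 - t * (sinh x / cosh x) * (sinh x * cosh x / (t * sinh x ^ 2 + 1))| ≤
        |(1 + t * x ^ 2)⁻¹| := by
      have : 1 - t * (sinh x / cosh x) * (sinh x * cosh x / (t * sinh x ^ 2 + 1)) =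
          (t * sinh x ^ 2 + 1)⁻¹ := by
        have := (hden x).ne'
        field_simp
        ring
      rw [this, abs_of_pos (inv_pos.2 (hden x)), abs_of_pos (inv_pos.2 hpos)]
      exact inv_anti₀ hpos hxs
    have e2 : |((cosh x * cosh x + sinh x * sinh x) * (t * sinh x ^ 2 + 1) -
        sinh x * cosh x * (t * (2 * sinh x * cosh x))) / (t * sinh x ^ 2 + 1) ^ 2| ≤
        3 * |(1 + t * x ^ 2)⁻¹| := by
      have e3 : (cosh x * cosh x + sinh x * sinh x) * (t * sinh x ^ 2 + 1) -
        sinh x * cosh x * (t * (2 * sinh x * cosh x)) =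
          1 + 2 * sinh x ^ 2 - t * sinh x ^ 2 := by
        have : cosh x * cosh x = sinh x ^ 2 + 1 := by rw [← hcs]; ring
        linear_combination (t * sinh x ^ 2 + 1 - 2 * t * sinh x ^ 2) * this
      rw [e3, abs_div, abs_of_pos (inv_pos.2 hpos), abs_of_pos (pow_pos (hden x) 2)]
      have e4 : |1 + 2 * sinh x ^ 2 - t * sinh x ^ 2| ≤ 3 * (t * sinh x ^ 2 + 1) := by
        rw [abs_le]
        constructor <;> nlinarith [sq_nonneg (sinh x)]
      calc _ ≤ 3 * (t * sinh x ^ 2 + 1) / (t * sinh x ^ 2 + 1) ^ 2 := by gcongr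
        _ = 3 * (t * sinh x ^ 2 + 1)⁻¹ := by have := (hden x).ne'; field_simp
        _ ≤ 3 * (1 + t * x ^ 2)⁻¹ := by gcongr
    have e5 : ‖(s * cosh x) • g' (s * sinh x)‖ ≤ K * |s * cosh x / (1 + (s * sinh x) ^ 2)| := by
      rw [norm_smul, abs_div, abs_of_pos (show 0 < 1 + (s * sinh x) ^ 2 by positivity),
        Real.norm_eq_abs]
      calc _ ≤ |s * cosh x| * (K / (1 + (s * sinh x) ^ 2)) := by gcongr; exact hg'K _
        _ = _ := by ring
    calc _ ≤ K * |(1 + t * x ^ 2)⁻¹| +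
          K * |s * cosh x / (1 + (s * sinh x) ^ 2)| * (3 / 2 / √t) +
          K * (3 * |(1 + t * x ^ 2)⁻¹|) := by
            gcongr
            exact hqb x
      _ = _ := by ring

theorem hasDerivAt_coshOsc {g g' : ℝ → ℂ} {K s t : ℝ} (hs : 0 < s) (hs1 : s < 1)
    (hg' : ∀ z, HasDerivAt g (g' z) z) (hgK : ∀ z, ‖g z‖ ≤ K / √(1 + z ^ 2))
    (hg'K : ∀ z, ‖g' z‖ ≤ K / (1 + z ^ 2)) (hg'c : Continuous g') :
    HasDerivAt (coshOsc t g) (s⁻¹ • coshOsc t (fun z => z • g' z) s) s := by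
  have hK : 0 ≤ K := by simpa using (norm_nonneg _).trans (hgK 0)
  have hgc : Continuous g := continuous_iff_continuousAt.2 fun x => (hg' x).continuousAt
  have ne : ∀ x : ℝ, ‖Complex.exp (Complex.I * ((t * log (cosh x) : ℝ) : ℂ))‖ = 1 := by
    intro x
    simp [Complex.norm_exp]
  have ce : Continuous fun x : ℝ => Complex.exp (Complex.I * ((t * log (cosh x) : ℝ) : ℂ)) := by
    have : Continuous fun x : ℝ => log (cosh x) :=
      continuous_cosh.log fun x => (cosh_pos x).ne'
    fun_prop
  have h := (hasDerivAt_integral_of_dominated_loc_of_deriv_le (𝕜 := ℝ) (μ := volume)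
    (F := fun s ξ => Complex.exp (Complex.I * ((t * log (cosh ξ) : ℝ) : ℂ)) * g (s * sinh ξ))
    (F' := fun s ξ => Complex.exp (Complex.I * ((t * log (cosh ξ) : ℝ) : ℂ)) *
      (sinh ξ • g' (s * sinh ξ))) (x₀ := s) (s := Set.Ioo (s / 2) 1)
    (bound := fun ξ => K / (s / 2) ^ 2 * (cosh ξ)⁻¹)
    (Ioo_mem_nhds (by linarith) hs1) ?_ ?_ ?_ ?_ ?_ ?_).2
  · refine h.congr_deriv ?_
    rw [coshOsc, ← integral_smul]
    refine integral_congr_ae (Filter.Eventually.of_forall fun x => ?_)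
    have : (s : ℂ) ≠ 0 := by exact_mod_cast hs.ne'
    simp only [Complex.real_smul]
    push_cast
    field_simp
  · exact Filter.Eventually.of_forall fun r =>
      (ce.mul (hgc.comp (by fun_prop))).aestronglyMeasurable
  · refine (integrable_comp_mul_sinh hgc hgK hs hs1.le).norm.mono'
      (ce.mul (hgc.comp (by fun_prop))).aestronglyMeasurable
      (Filter.Eventually.of_forall fun x => ?_)
    rw [norm_mul, ne, one_mul]
  · exact (ce.mul (continuous_sinh.smul (hg'c.comp (by fun_prop)))).aestronglyMeasurable
  · refine Filter.Eventually.of_forall fun x r hr => ?_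
    have hc := cosh_pos x
    have hr0 : 0 < r := by linarith [hr.1]
    rw [norm_mul, ne, one_mul, norm_smul, Real.norm_eq_abs]
    have h1 : |sinh x| ≤ cosh x := by
      refine abs_le_of_sq_le_sq ?_ hc.le
      rw [cosh_sq]; linarith
    have h2 : (s / 2) ^ 2 * cosh x ^ 2 ≤ 1 + (r * sinh x) ^ 2 := by
      have h3 := mul_cosh_le_sqrt hr0 hr.2.le x
      have h4 : (r * cosh x) ^ 2 ≤ 1 + (r * sinh x) ^ 2 :=
        (le_sqrt' (by positivity)).1 h3
      refine le_trans ?_ h4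
      rw [mul_pow]
      have : s / 2 ≤ r := hr.1.le
      gcongr
    calc |sinh x| * ‖g' (r * sinh x)‖ ≤ cosh x * (K / (1 + (r * sinh x) ^ 2)) := by
          gcongr; exact hg'K _
      _ ≤ cosh x * (K / ((s / 2) ^ 2 * cosh x ^ 2)) := by gcongr
      _ = _ := by field_simp
  · exact integrable_inv_cosh.const_mul _
  · refine Filter.Eventually.of_forall fun x r hr => ?_
    refine HasDerivAt.const_mul _ ?_
    exact (hg' _).scomp r (by simpa using (hasDerivAt_id r).mul_const (sinh x))

theorem integral_exp_neg_abs_div_two : ∫ x : ℝ, exp (-|x| / 2) = 4 := by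
  rw [integral_comp_abs (f := fun x => exp (-x / 2))]
  have : (fun x : ℝ => exp (-x / 2)) = fun x => exp ((-1 / 2) * x) := by
    ext x; ring_nf
  rw [this, integral_exp_mul_Ioi (by norm_num)]
  norm_num

theorem integrable_exp_neg_abs_div_two : Integrable (fun x : ℝ => exp (-|x| / 2)) := by
  refine Integrable.of_integral_ne_zero ?_
  rw [integral_exp_neg_abs_div_two]
  norm_num

theorem cosh_le_exp_abs (x : ℝ) : cosh x ≤ exp |x| := by
  rw [← cosh_abs, cosh_eq]
  have : exp (-|x|) ≤ exp |x| := exp_le_exp.2 (by linarith [abs_nonneg x])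
  linarith

theorem exp_abs_le_two_mul_cosh (x : ℝ) : exp |x| ≤ 2 * cosh x := by
  rw [← cosh_abs, cosh_eq]
  linarith [exp_pos (-|x|)]

theorem sqrt_inv_cosh_le (x : ℝ) : √(cosh x)⁻¹ ≤ 2 * exp (-|x| / 2) := by
  rw [sqrt_le_left (by positivity), mul_pow, ← exp_nat_mul]
  have h := exp_abs_le_two_mul_cosh x
  have : ((2 : ℕ) : ℝ) * (-|x| / 2) = -|x| := by push_cast; ring
  rw [this, exp_neg, inv_le_comm₀ (cosh_pos x) (by positivity)]
  rw [mul_inv, inv_inv]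
  linarith [exp_pos |x|]

theorem integrable_sqrt_inv_cosh :
    Integrable (fun x : ℝ => √(cosh x)⁻¹) ∧ ∫ x : ℝ, √(cosh x)⁻¹ ≤ 8 := by
  have h : Integrable (fun x : ℝ => √(cosh x)⁻¹) := by
    refine (integrable_exp_neg_abs_div_two.const_mul 2).mono' ?_
      (Filter.Eventually.of_forall fun x => ?_)
    · exact (continuous_cosh.inv₀ fun x => (cosh_pos x).ne').sqrt.aestronglyMeasurable
    · rw [norm_of_nonneg (sqrt_nonneg _)]
      exact sqrt_inv_cosh_le x
  refine ⟨h, ?_⟩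
  calc _ ≤ ∫ x : ℝ, 2 * exp (-|x| / 2) :=
        integral_mono h (integrable_exp_neg_abs_div_two.const_mul 2) sqrt_inv_cosh_le
    _ = 8 := by rw [integral_const_mul, integral_exp_neg_abs_div_two]; norm_num

theorem hasDerivAt_mul_inv_cosh_add (n κ x : ℝ) :
    HasDerivAt (fun x => n * (cosh x)⁻¹ + κ) (-(n * sinh x / cosh x ^ 2)) x := by
  refine (((hasDerivAt_cosh x).inv (cosh_pos x).ne').const_mul n |>.add_const κ).congr_deriv ?_
  ring

theorem integrable_sinh_div_cosh_sq_weight {n m : ℝ} (hn : 0 ≤ n) (hm : 0 < m) (κ : ℝ) :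
    Integrable (fun x => |n * sinh x / cosh x ^ 2 / ((n * (cosh x)⁻¹ + κ) ^ 2 + m ^ 2)|) ∧
      ∫ x, |n * sinh x / cosh x ^ 2 / ((n * (cosh x)⁻¹ + κ) ^ 2 + m ^ 2)| ≤ 2 * π / m := by
  have h := integrable_abs_of_hasDerivAt_of_bounded
    (G := fun x => -(arctan ((n * (cosh x)⁻¹ + κ) / m) / m))
    (g := fun x => n * sinh x / cosh x ^ 2 / ((n * (cosh x)⁻¹ + κ) ^ 2 + m ^ 2))
    (B := π / 2 / m) (σ₁ := 1) (σ₂ := -1)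
    (fun x => ?_) ?_ (fun x => ?_) (fun x hx => ?_) (fun x hx => ?_) (by simp) (by simp)
  · exact ⟨h.1, h.2.trans_eq (by ring)⟩
  · refine (((((hasDerivAt_mul_inv_cosh_add n κ x).div_const m).arctan).div_const m).neg).congr_deriv
      ?_
    have hc := (cosh_pos x).ne'
    have h1 : 1 + ((n * (cosh x)⁻¹ + κ) / m) ^ 2 ≠ 0 := by positivity
    have h2 : (n * (cosh x)⁻¹ + κ) ^ 2 + m ^ 2 ≠ 0 := by positivity
    have h3 : 1 + ((n * (cosh x)⁻¹ + κ) / m) ^ 2 =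
      ((n * (cosh x)⁻¹ + κ) ^ 2 + m ^ 2) / m ^ 2 := by field_simp; ring
    rw [h3]
    generalize (n * (cosh x)⁻¹ + κ) ^ 2 + m ^ 2 = Q at h2
    field_simp
  · have hc : ∀ x, cosh x ≠ 0 := fun x => (cosh_pos x).ne'
    refine Continuous.div ?_ ?_ fun x => by positivity
    · exact Continuous.div (by fun_prop) (by fun_prop) fun x => pow_ne_zero 2 (hc x)
    · have : Continuous fun x => (cosh x)⁻¹ := continuous_cosh.inv₀ hc
      fun_prop
  · rw [abs_neg, abs_div, abs_of_pos hm]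
    gcongr
    exact abs_le.2 ⟨(neg_pi_div_two_lt_arctan _).le, (arctan_lt_pi_div_two _).le⟩
  · have := sinh_nonneg_iff.2 hx
    rw [one_mul, abs_of_nonneg (by positivity)]
  · have := sinh_nonpos_iff.2 hx
    rw [neg_one_mul, abs_of_nonpos]
    refine div_nonpos_of_nonpos_of_nonneg (div_nonpos_of_nonpos_of_nonneg ?_ (by positivity))
      (by positivity)
    exact mul_nonpos_of_nonneg_of_nonpos hn this

/-- The phase `n · gd(x) + κ x`, up to an additive constant. -/
noncomputable def gdPhase (n κ x : ℝ) : ℝ := n * (2 * arctan (exp x)) + κ * x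

theorem hasDerivAt_two_mul_arctan_exp (x : ℝ) :
    HasDerivAt (fun x => 2 * arctan (exp x)) (cosh x)⁻¹ x := by
  refine (((hasDerivAt_exp x).arctan).const_mul 2).congr_deriv ?_
  have h := exp_pos x
  rw [cosh_eq, exp_neg]
  field_simp
  ring

theorem hasDerivAt_gdPhase (n κ x : ℝ) :
    HasDerivAt (gdPhase n κ) (n * (cosh x)⁻¹ + κ) x := by
  exact (((hasDerivAt_two_mul_arctan_exp x).const_mul n).add
    ((hasDerivAt_id x).const_mul κ)).congr_deriv (by simp)

theorem norm_integral_gdPhase_le {n κ m : ℝ} (hm : 0 < m) {b b' : ℝ → ℂ} {D : ℝ → ℝ}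
    (hb : ∀ x, HasDerivAt b (b' x) x) (hbi : Integrable b) (hD : Integrable D)
    (hle : ∀ x, ‖b x‖ * (m ^ 2 / ((n * (cosh x)⁻¹ + κ) ^ 2 + m ^ 2)) +
      ‖b' x‖ * (|n * (cosh x)⁻¹ + κ| / ((n * (cosh x)⁻¹ + κ) ^ 2 + m ^ 2)) +
      ‖b x‖ * (|n * sinh x / cosh x ^ 2| / ((n * (cosh x)⁻¹ + κ) ^ 2 + m ^ 2)) ≤ D x) :
    ‖∫ x, Complex.exp (Complex.I * (gdPhase n κ x : ℂ)) * b x‖ ≤ ∫ x, D x := by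
  have hden : ∀ x, 0 < (n * (cosh x)⁻¹ + κ) ^ 2 + m ^ 2 := fun x => by positivity
  have hqd : ∀ x, HasDerivAt
      (fun x => (n * (cosh x)⁻¹ + κ) / ((n * (cosh x)⁻¹ + κ) ^ 2 + m ^ 2)) _ x := fun x =>
    (hasDerivAt_mul_inv_cosh_add n κ x).div
      (((hasDerivAt_mul_inv_cosh_add n κ x).pow 2).add_const (m ^ 2)) (hden x).ne'
  refine norm_integral_exp_mul_le (hasDerivAt_gdPhase n κ) hqd hb hbi
    (M := 1 / (2 * m)) (fun x => ?_) hD fun x => le_trans ?_ (hle x)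
  · rw [abs_div, abs_of_pos (hden x), div_le_div_iff₀ (hden x) (by positivity),
      ← sq_abs (n * (cosh x)⁻¹ + κ)]
    nlinarith [sq_nonneg (|n * (cosh x)⁻¹ + κ| - m)]
  · have hd := hden x
    have e1 : |1 - (n * (cosh x)⁻¹ + κ) *
        ((n * (cosh x)⁻¹ + κ) / ((n * (cosh x)⁻¹ + κ) ^ 2 + m ^ 2))| =
        m ^ 2 / ((n * (cosh x)⁻¹ + κ) ^ 2 + m ^ 2) := by
      rw [← abs_of_pos (show 0 < m ^ 2 / ((n * (cosh x)⁻¹ + κ) ^ 2 + m ^ 2) by positivity)]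
      congr 1
      have := hd.ne'
      generalize n * (cosh x)⁻¹ + κ = p at this
      field_simp
      ring
    rw [e1, abs_div, abs_of_pos hd]
    refine add_le_add le_rfl (mul_le_mul_of_nonneg_left ?_ (norm_nonneg _))
    generalize n * (cosh x)⁻¹ + κ = p at hd
    generalize n * sinh x / cosh x ^ 2 = p'
    rw [abs_div, abs_of_pos (pow_pos hd 2), div_le_div_iff₀ (pow_pos hd 2) hd]
    have e2 : -p' * (p ^ 2 + m ^ 2) - p * (((2 : ℕ) : ℝ) * p ^ (2 - 1) * -p') =
        p' * (p ^ 2 - m ^ 2) := by push_cast; ring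
    rw [e2, abs_mul, sq (p ^ 2 + m ^ 2), ← mul_assoc]
    gcongr
    rw [abs_le]
    constructor <;> nlinarith [sq_nonneg p, sq_nonneg m]

theorem abs_sub_le_abs_add {a κ s : ℝ} (ha : 0 ≤ a) (hs : 0 ≤ s) (hκ : |κ| = s) :
    |a - s| ≤ |a + κ| := by
  rcases abs_choice κ with h | h
  · rw [h] at hκ
    subst hκ
    rw [abs_of_nonneg (show 0 ≤ a + κ by linarith)]
    exact abs_le.2 ⟨by linarith, by linarith⟩
  · have : κ = -s := by linarith
    rw [this, ← sub_eq_add_neg]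

set_option maxHeartbeats 1000000 in
/-- Airy-type bound, uniform across the coalescence of the two stationary points. -/
theorem norm_integral_gdPhase_le_airy {n κ m K : ℝ} (hm : 1 ≤ m) (hn : m ^ 3 < 4 * n)
    (hκ : |κ| = m ^ 3 / 2) {b b' : ℝ → ℂ} (hb : ∀ x, HasDerivAt b (b' x) x)
    (hbK : ∀ x, ‖b x‖ ≤ K * √(cosh x)⁻¹) (hb'K : ∀ x, ‖b' x‖ ≤ K * √(cosh x)⁻¹) :
    ‖∫ x, Complex.exp (Complex.I * (gdPhase n κ x : ℂ)) * b x‖ ≤ 300 * K / m := by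
  have hK : 0 ≤ K := by simpa using (norm_nonneg _).trans (hbK 0)
  have hm0 : 0 < m := by linarith
  have hm3 : 0 < m ^ 3 := by positivity
  have hn0 : 0 < n := by linarith
  obtain ⟨iv, bv⟩ := integrable_sqrt_inv_cosh
  obtain ⟨iW, bW⟩ := integrable_sinh_div_cosh_sq_weight hn0.le hm0 (-(m ^ 3 / 2))
  set W : ℝ → ℝ := fun x =>
    |n * sinh x / cosh x ^ 2 / ((n * (cosh x)⁻¹ + -(m ^ 3 / 2)) ^ 2 + m ^ 2)| with hW
  have cb : Continuous b := continuous_iff_continuousAt.2 fun x => (hb x).continuousAt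
  have ib : Integrable b :=
    (iv.const_mul K).mono' cb.aestronglyMeasurable (Filter.Eventually.of_forall hbK)
  set J : ℝ → ℝ := (Set.Icc (-(1 / m)) (1 / m)).indicator fun _ => (1 : ℝ) with hJ
  have iJ : Integrable J := by
    refine (integrable_indicator_iff measurableSet_Icc).2 ?_
    simp
  have bJ : ∫ x, J x = 2 / m := by
    rw [hJ, integral_indicator measurableSet_Icc]
    have : 0 ≤ 1 / m + 1 / m := by positivity
    simp only [setIntegral_const, smul_eq_mul, mul_one, measureReal_def, volume_Icc]
    rw [sub_neg_eq_add, ENNReal.toReal_ofReal this]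
    ring
  have hD : Integrable fun x =>
      K * (17 / m * √(cosh x)⁻¹ + 9 * W x + J x) :=
    (((iv.const_mul _).add (iW.const_mul _)).add iJ).const_mul K
  refine (norm_integral_gdPhase_le hm0 hb ib hD fun x => ?_).trans ?_
  · have hJ0 : 0 ≤ J x := Set.indicator_nonneg (fun _ _ => zero_le_one) x
    have hc := cosh_pos x
    have hc1 := one_le_cosh x
    set v := √(cosh x)⁻¹ with hv
    have hv0 : 0 < v := sqrt_pos.2 (inv_pos.2 hc)
    have hvv : (cosh x)⁻¹ = v ^ 2 := (sq_sqrt (inv_pos.2 hc).le).symm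
    have hv1 : v ≤ 1 := by
      rw [hv, sqrt_le_left zero_le_one, one_pow]; exact inv_le_one_of_one_le₀ hc1
    have hp0 : (n * (cosh x)⁻¹ + -(m ^ 3 / 2)) ^ 2 ≤ (n * (cosh x)⁻¹ + κ) ^ 2 := by
      rw [← sub_eq_add_neg]
      exact sq_le_sq.2 (abs_sub_le_abs_add (by positivity) (by positivity) hκ)
    have hWx : W x = |n * sinh x / cosh x ^ 2| /
        ((n * (cosh x)⁻¹ + -(m ^ 3 / 2)) ^ 2 + m ^ 2) := by
      simp only [hW]
      rw [abs_div, abs_of_pos (show 0 < (n * (cosh x)⁻¹ + -(m ^ 3 / 2)) ^ 2 + m ^ 2 by positivity)]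
    have hW0 : 0 ≤ W x := abs_nonneg _
    have t2 : |n * sinh x / cosh x ^ 2| / ((n * (cosh x)⁻¹ + κ) ^ 2 + m ^ 2) ≤ W x := by
      rw [hWx]; gcongr
    have t1 : |n * (cosh x)⁻¹ + κ| / ((n * (cosh x)⁻¹ + κ) ^ 2 + m ^ 2) ≤ 1 / m := by
      rw [div_le_div_iff₀ (by positivity) hm0, ← sq_abs (n * (cosh x)⁻¹ + κ)]
      nlinarith [sq_nonneg (|n * (cosh x)⁻¹ + κ| - m), sq_nonneg m,
        sq_nonneg (|n * (cosh x)⁻¹ + κ|)]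
    have t3 : v * (m ^ 2 / ((n * (cosh x)⁻¹ + κ) ^ 2 + m ^ 2)) ≤ 16 / m * v + 8 * W x + J x := by
      have h1 : v * (m ^ 2 / ((n * (cosh x)⁻¹ + κ) ^ 2 + m ^ 2)) ≤
          v * (m ^ 2 / ((n * (cosh x)⁻¹ + -(m ^ 3 / 2)) ^ 2 + m ^ 2)) := by gcongr
      refine h1.trans ?_
      by_cases hx : |x| ≤ 1 / m
      · have hJ1 : J x = 1 := by
          rw [hJ, Set.indicator_of_mem]
          exact abs_le.1 hx
        rw [hJ1]
        have : m ^ 2 / ((n * (cosh x)⁻¹ + -(m ^ 3 / 2)) ^ 2 + m ^ 2) ≤ 1 := by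
          rw [div_le_one (by positivity)]
          nlinarith [sq_nonneg (n * (cosh x)⁻¹ + -(m ^ 3 / 2))]
        have h2 : v * (m ^ 2 / ((n * (cosh x)⁻¹ + -(m ^ 3 / 2)) ^ 2 + m ^ 2)) ≤ 1 * 1 := by
          gcongr
        have h3 : 0 ≤ 16 / m * v := by positivity
        linarith
      · by_cases hu : n * (cosh x)⁻¹ < m ^ 3 / 4
        · have h2 : (m ^ 3 / 4) ^ 2 ≤ (n * (cosh x)⁻¹ + -(m ^ 3 / 2)) ^ 2 := by
            rw [← sq_abs (n * (cosh x)⁻¹ + -(m ^ 3 / 2))]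
            have : m ^ 3 / 4 ≤ |n * (cosh x)⁻¹ + -(m ^ 3 / 2)| := by
              rw [abs_of_nonpos (by linarith)]; linarith
            gcongr
          have h3 : m ^ 2 / ((n * (cosh x)⁻¹ + -(m ^ 3 / 2)) ^ 2 + m ^ 2) ≤ 16 / m := by
            rw [div_le_div_iff₀ (by positivity) hm0]
            have h4 : m ^ 3 ≤ m ^ 6 := pow_le_pow_right₀ hm (by norm_num)
            nlinarith [sq_nonneg m]
          have h4 : v * (m ^ 2 / ((n * (cosh x)⁻¹ + -(m ^ 3 / 2)) ^ 2 + m ^ 2)) ≤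
            v * (16 / m) := by gcongr
          linarith
        · have h2 : v * m ^ 2 ≤ 8 * |n * sinh x / cosh x ^ 2| := by
            push Not at hx hu
            have hs : cosh x ≤ 2 * m * |sinh x| := by
              have h3 : 1 / m ≤ |sinh x| := hx.le.trans (abs_le_abs_sinh x)
              have h4 : 1 ≤ m * |sinh x| := by
                rw [div_le_iff₀ hm0] at h3; linarith
              refine (sq_le_sq₀ hc.le (by positivity)).1 ?_
              have h5 : |sinh x| ≤ m * |sinh x| := le_mul_of_one_le_left (abs_nonneg _) hm
              rw [cosh_sq, ← sq_abs (sinh x), mul_assoc]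
              generalize m * |sinh x| = y at h4 h5
              have h6 : |sinh x| ^ 2 ≤ y ^ 2 := by gcongr
              nlinarith
            have h6 : |n * sinh x / cosh x ^ 2| = n * v ^ 2 * (|sinh x| / cosh x) := by
              rw [abs_div, abs_mul, abs_of_pos hn0, abs_of_pos (pow_pos hc 2), ← hvv]
              field_simp
            have h7 : 1 / (2 * m) ≤ |sinh x| / cosh x := by
              rw [div_le_div_iff₀ (by positivity) hc]; linarith
            have h8 : m ^ 3 / 4 ≤ n * v := by
              rw [hvv] at hu
              refine (sq_le_sq₀ (by positivity) (by positivity)).1 ?_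
              have : m ^ 3 / 4 * (m ^ 3 / 4) ≤ n * (n * v ^ 2) := by
                gcongr; linarith
              nlinarith
            rw [h6]
            calc v * m ^ 2 = 8 * (m ^ 3 / 4 * v * (1 / (2 * m))) := by field_simp; norm_num
              _ ≤ 8 * (n * v * v * (|sinh x| / cosh x)) := by gcongr
              _ = _ := by ring
          have h3 : v * (m ^ 2 / ((n * (cosh x)⁻¹ + -(m ^ 3 / 2)) ^ 2 + m ^ 2)) ≤ 8 * W x := by
            rw [hWx, ← mul_div_assoc, ← mul_div_assoc]
            gcongr
          have h4 : 0 ≤ 16 / m * v := by positivity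
          linarith
    have hbx := hbK x
    have hbx1 : ‖b x‖ ≤ K * 1 := hbx.trans (by gcongr)
    calc _ ≤ K * v * (m ^ 2 / ((n * (cosh x)⁻¹ + κ) ^ 2 + m ^ 2)) + K * v * (1 / m) +
          K * 1 * W x := by
            gcongr
            exact hb'K x
      _ = K * (v * (m ^ 2 / ((n * (cosh x)⁻¹ + κ) ^ 2 + m ^ 2)) + 1 / m * v + W x) := by ring
      _ ≤ K * ((16 / m * v + 8 * W x + J x) + 1 / m * v + W x) := by gcongr
      _ = _ := by ring
  · have i1 : Integrable fun x => 17 / m * √(cosh x)⁻¹ + 9 * W x :=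
      (iv.const_mul _).add (iW.const_mul _)
    rw [integral_const_mul, integral_add i1 iJ,
      integral_add (iv.const_mul _) (iW.const_mul _), integral_const_mul, integral_const_mul, bJ]
    have hpi := pi_lt_four
    calc _ ≤ K * (17 / m * 8 + 9 * (2 * 4 / m) + 2 / m) := by
          gcongr
          refine bW.trans ?_
          gcongr
      _ = 210 * K / m := by ring
      _ ≤ 300 * K / m := by gcongr; norm_num

theorem integrable_exp_neg_abs_abs_sub (a : ℝ) :
    Integrable (fun x : ℝ => exp (-|(|x| - a)| / 2)) ∧
      ∫ x : ℝ, exp (-|(|x| - a)| / 2) ≤ 8 := by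
  have i1 : Integrable fun x : ℝ => exp (-|x - a| / 2) :=
    integrable_exp_neg_abs_div_two.comp_sub_right a
  have i2 : Integrable fun x : ℝ => exp (-|x + a| / 2) :=
    integrable_exp_neg_abs_div_two.comp_add_right a
  have hle : ∀ x : ℝ, exp (-|(|x| - a)| / 2) ≤ exp (-|x - a| / 2) + exp (-|x + a| / 2) := by
    intro x
    rcases abs_choice x with h | h
    · rw [h]; linarith [exp_pos (-|x + a| / 2)]
    · rw [h, show -x - a = -(x + a) by ring, abs_neg]; linarith [exp_pos (-|x - a| / 2)]
  have i0 : Integrable (fun x : ℝ => exp (-|(|x| - a)| / 2)) := by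
    refine (i1.add i2).mono' (by fun_prop) (Filter.Eventually.of_forall fun x => ?_)
    rw [norm_of_nonneg (exp_pos _).le]
    exact hle x
  refine ⟨i0, (integral_mono i0 (i1.add i2) hle).trans_eq ?_⟩
  simp only [Pi.add_apply]
  rw [integral_add i1 i2, integral_sub_right_eq_self (fun x : ℝ => exp (-|x| / 2)) a,
    integral_add_right_eq_self (fun x : ℝ => exp (-|x| / 2)) a, integral_exp_neg_abs_div_two]
  norm_num

theorem sq_exp_neg_abs_sub_log {x L : ℝ} (hL : 0 < L) :
    (exp |x| ≤ L → exp (-|(|x| - log L)| / 2) ^ 2 = exp |x| / L) ∧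
      (L ≤ exp |x| → exp (-|(|x| - log L)| / 2) ^ 2 = L / exp |x|) := by
  have e : exp (-|(|x| - log L)| / 2) ^ 2 = exp (-|(|x| - log L)|) := by
    rw [← exp_nat_mul]; congr 1; push_cast; ring
  rw [e]
  constructor
  · intro h
    rw [abs_of_nonpos (by linarith [(le_log_iff_exp_le hL).2 h]), neg_neg, exp_sub, exp_log hL]
  · intro h
    rw [abs_of_nonneg (by linarith [(log_le_iff_le_exp hL).2 h]), neg_sub, exp_sub, exp_log hL]

set_option maxHeartbeats 1000000 in
/-- Pointwise control of the integration-by-parts terms away from the stationary points and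
near them, when the amplitude vanishes at the centre. -/
theorem gdPhase_weight_le {n t x κ : ℝ} (ht : 1 ≤ t) (hn : t < 4 * n) (hκ : |κ| = t / 2) :
    √(cosh x)⁻¹ * (|sinh x| / cosh x) * (t / ((n * (cosh x)⁻¹ + κ) ^ 2 + t)) +
      √(cosh x)⁻¹ * (|n * (cosh x)⁻¹ + κ| / ((n * (cosh x)⁻¹ + κ) ^ 2 + t)) +
      √(cosh x)⁻¹ * (|sinh x| / cosh x) *
        (|n * sinh x / cosh x ^ 2| / ((n * (cosh x)⁻¹ + κ) ^ 2 + t)) ≤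
    (24 * exp (-|(|x| - log (4 * n / t))| / 2) + 3 * √t *
      (|n * sinh x / cosh x ^ 2| / ((n * (cosh x)⁻¹ + -(t / 2)) ^ 2 + t))) / √n := by
  have ht0 : 0 < t := by linarith
  have hn0 : 0 < n := by linarith
  have hc := cosh_pos x
  have hc1 := one_le_cosh x
  have hY1 := cosh_le_exp_abs x
  have hY2 := exp_abs_le_two_mul_cosh x
  have hL : 0 < 4 * n / t := by positivity
  obtain ⟨hE1, hE2⟩ := sq_exp_neg_abs_sub_log (x := x) hL
  have hE0 := exp_pos (-|(|x| - log (4 * n / t))| / 2)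
  set E := exp (-|(|x| - log (4 * n / t))| / 2)
  set Y := exp |x|
  have hY0 : 0 < Y := exp_pos _
  have hp' : |n * sinh x / cosh x ^ 2| = n * (cosh x)⁻¹ * (|sinh x| / cosh x) := by
    rw [abs_div, abs_mul, abs_of_pos hn0, abs_of_pos (pow_pos hc 2)]
    field_simp
  rw [hp']
  have hth0 : 0 ≤ |sinh x| / cosh x := by positivity
  have hth1 : |sinh x| / cosh x ≤ 1 := by
    rw [div_le_one hc, ← cosh_abs, abs_sinh]; exact (sinh_lt_cosh _).le
  set th := |sinh x| / cosh x
  have hP := abs_sub_le_abs_add (a := n * (cosh x)⁻¹) (s := t / 2) (by positivity)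
    (by positivity) hκ
  have hcv : cosh x = (√(cosh x)⁻¹ ^ 2)⁻¹ := by rw [sq_sqrt (inv_pos.2 hc).le, inv_inv]
  have hv0 : 0 < √(cosh x)⁻¹ := sqrt_pos.2 (inv_pos.2 hc)
  have hvv : (cosh x)⁻¹ = √(cosh x)⁻¹ ^ 2 := (sq_sqrt (inv_pos.2 hc).le).symm
  set v := √(cosh x)⁻¹
  rw [hvv] at hP ⊢
  rw [hcv] at hc1 hY1 hY2
  have hYv1 : 1 ≤ v ^ 2 * Y := by
    rw [inv_le_iff_one_le_mul₀ (by positivity)] at hY1; linarith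
  have hYv2 : v ^ 2 * Y ≤ 2 := by
    rw [← div_eq_mul_inv, le_div_iff₀ (by positivity)] at hY2; linarith
  have hr : √n ^ 2 = n := sq_sqrt hn0.le
  have hs : √t ^ 2 = t := sq_sqrt ht0.le
  have hr0 : 0 < √n := sqrt_pos.2 hn0
  have hs0 : 0 < √t := sqrt_pos.2 ht0
  have hs1 : 1 ≤ √t := by rw [le_sqrt' one_pos]; linarith
  set r := √n
  set s := √t
  set P := n * v ^ 2 + κ
  have hQ : 0 < P ^ 2 + t := by positivity
  have hP0 : (n * v ^ 2 + -(t / 2)) ^ 2 ≤ P ^ 2 := by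
    rw [← sub_eq_add_neg]; exact sq_le_sq.2 hP
  have hQ0 : 0 < (n * v ^ 2 + -(t / 2)) ^ 2 + t := by positivity
  have hW0 : 0 ≤ n * v ^ 2 * th / ((n * v ^ 2 + -(t / 2)) ^ 2 + t) := by positivity
  have hW1 : n * v ^ 2 * th / (P ^ 2 + t) ≤
      n * v ^ 2 * th / ((n * v ^ 2 + -(t / 2)) ^ 2 + t) := by gcongr
  set W := n * v ^ 2 * th / ((n * v ^ 2 + -(t / 2)) ^ 2 + t) with hW
  have hPQ : ∀ c : ℝ, 0 < c → c ≤ |P| → |P| / (P ^ 2 + t) ≤ 1 / c ∧ c ^ 2 ≤ P ^ 2 + t := by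
    intro c hc hcP
    have : c ^ 2 ≤ |P| ^ 2 := by gcongr
    rw [sq_abs] at this
    refine ⟨?_, by linarith⟩
    rw [div_le_div_iff₀ hQ hc, ← sq_abs P]
    nlinarith [abs_nonneg P]
  rcases lt_or_ge t (n * v ^ 2) with h | h
  · have hPc : n * v ^ 2 / 2 ≤ |P| := by
      refine le_trans ?_ hP
      rw [abs_of_nonneg (by linarith)]; linarith
    obtain ⟨h1, h2⟩ := hPQ _ (by positivity) hPc
    have hYL : Y ≤ 4 * n / t := by
      rw [le_div_iff₀ ht0]
      have : Y * t ≤ Y * (n * v ^ 2) := by gcongr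
      nlinarith
    have key : 1 / (n * v) ≤ 2 * E / r := by
      refine (sq_le_sq₀ (by positivity) (by positivity)).1 ?_
      rw [div_pow, div_pow, mul_pow, mul_pow, hE1 hYL, hr, div_le_div_iff₀ (by positivity) hn0]
      have : 2 ^ 2 * (Y / (4 * n / t)) * (n ^ 2 * v ^ 2) = (v ^ 2 * Y) * t * n := by
        field_simp; ring
      rw [this]
      have : 1 * 1 * n ≤ v ^ 2 * Y * t * n := by gcongr
      linarith
    have T1 : v * th * (t / (P ^ 2 + t)) ≤ 4 * (1 / (n * v)) := by
      calc _ ≤ v * 1 * (n * v ^ 2 / (n * v ^ 2 / 2) ^ 2) := by gcongr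
        _ = _ := by field_simp; norm_num
    have T2 : v * (|P| / (P ^ 2 + t)) ≤ 2 * (1 / (n * v)) := by
      calc _ ≤ v * (1 / (n * v ^ 2 / 2)) := by gcongr
        _ = _ := by field_simp
    have T3 : v * th * (n * v ^ 2 * th / (P ^ 2 + t)) ≤ 4 * (1 / (n * v)) := by
      calc _ ≤ v * 1 * (n * v ^ 2 * 1 / (n * v ^ 2 / 2) ^ 2) := by gcongr
        _ = _ := by field_simp; norm_num
    calc _ ≤ 10 * (2 * E / r) := by linarith
      _ = 20 * E / r := by ring
      _ ≤ _ := by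
        gcongr
        have : 0 ≤ 3 * s * W := by positivity
        linarith
  rcases lt_or_ge (n * v ^ 2) (t / 4) with h' | h'
  · have hPc : t / 4 ≤ |P| := by
      refine le_trans ?_ hP
      rw [abs_of_nonpos (by linarith)]; linarith
    obtain ⟨h1, h2⟩ := hPQ _ (by positivity) hPc
    have hYL : 4 * n / t ≤ Y := by
      rw [div_le_iff₀ ht0]
      have : Y * (n * v ^ 2) ≤ Y * (t / 4) := by gcongr
      nlinarith
    have key : v / t ≤ E / r := by
      refine (sq_le_sq₀ (by positivity) (by positivity)).1 ?_
      rw [div_pow, div_pow, hE2 hYL, hr, div_le_div_iff₀ (by positivity) hn0,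
        div_div, div_mul_eq_mul_div, le_div_iff₀ (by positivity)]
      calc v ^ 2 * n * (t * Y) = v ^ 2 * Y * n * t := by ring
        _ ≤ 2 * n * t ^ 2 := by gcongr; nlinarith
        _ ≤ _ := by nlinarith [mul_pos hn0 (pow_pos ht0 2)]
    have T1 : v * th * (t / (P ^ 2 + t)) ≤ 16 * (v / t) := by
      calc _ ≤ v * 1 * (t / (t / 4) ^ 2) := by gcongr
        _ = _ := by field_simp; norm_num
    have T2 : v * (|P| / (P ^ 2 + t)) ≤ 4 * (v / t) := by
      calc _ ≤ v * (1 / (t / 4)) := by gcongr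
        _ = _ := by field_simp
    have T3 : v * th * (n * v ^ 2 * th / (P ^ 2 + t)) ≤ 4 * (v / t) := by
      calc _ ≤ v * 1 * (t / 4 * 1 / (t / 4) ^ 2) := by gcongr
        _ = _ := by field_simp
    calc _ ≤ 24 * (E / r) := by linarith
      _ = 24 * E / r := by ring
      _ ≤ _ := by
        gcongr
        have : 0 ≤ 3 * s * W := by positivity
        linarith
  · have hrv1 : s / 2 ≤ r * v := by
      refine (sq_le_sq₀ (by positivity) (by positivity)).1 ?_
      rw [mul_pow, hr, div_pow, hs]; linarith
    have hrv2 : r * v ≤ s := by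
      refine (sq_le_sq₀ (by positivity) (by positivity)).1 ?_
      rw [mul_pow, hr, hs]; linarith
    have hE : 1 / 2 ≤ E := by
      refine (sq_le_sq₀ (by positivity) (by positivity)).1 ?_
      rcases le_total Y (4 * n / t) with hYL | hYL
      · rw [hE1 hYL, div_div_eq_mul_div, le_div_iff₀ (by positivity)]
        have : Y * (n * v ^ 2) ≤ Y * t := by gcongr
        nlinarith
      · rw [hE2 hYL, div_div, le_div_iff₀ (by positivity)]
        have : Y * (t / 4) ≤ Y * (n * v ^ 2) := by gcongr
        nlinarith
    have T1 : v * th * (t / (P ^ 2 + t)) ≤ 2 * s * W / r := by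
      calc v * th * (t / (P ^ 2 + t)) ≤
            v * th * (t / ((n * v ^ 2 + -(t / 2)) ^ 2 + t)) := by gcongr
        _ = s * W / r * (s / (r * v)) := by
            rw [hW, ← hr, ← hs]; field_simp
        _ ≤ s * W / r * 2 := by
            gcongr
            rw [div_le_iff₀ (by positivity)]; linarith
        _ = _ := by ring
    have T2 : v * (|P| / (P ^ 2 + t)) ≤ 24 * E / r := by
      have h1 : |P| / (P ^ 2 + t) ≤ 1 / (2 * s) := by
        rw [div_le_div_iff₀ hQ (by positivity), ← sq_abs P, ← hs]
        nlinarith [sq_nonneg (|P| - s)]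
      calc _ ≤ v * (1 / (2 * s)) := by gcongr
        _ = r * v / (2 * s * r) := by field_simp
        _ ≤ s / (2 * s * r) := by gcongr
        _ = (1 / 2) / r := by field_simp
        _ ≤ 24 * E / r := by gcongr; linarith
    have T3 : v * th * (n * v ^ 2 * th / (P ^ 2 + t)) ≤ s * W / r := by
      calc _ ≤ v * 1 * W := by gcongr
        _ = r * v * W / r := by field_simp
        _ ≤ _ := by gcongr
    calc _ ≤ 2 * s * W / r + 24 * E / r + s * W / r := by linarith
      _ = _ := by ring

/-- If the amplitude vanishes at the centre, there is no loss where the two stationary points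
coalesce. -/
theorem norm_integral_gdPhase_le_of_vanishing {n κ t K : ℝ} (ht : 1 ≤ t) (hn : t < 4 * n)
    (hκ : |κ| = t / 2) {b b' : ℝ → ℂ} (hb : ∀ x, HasDerivAt b (b' x) x)
    (hbK : ∀ x, ‖b x‖ ≤ K * (√(cosh x)⁻¹ * (|sinh x| / cosh x)))
    (hb'K : ∀ x, ‖b' x‖ ≤ K * √(cosh x)⁻¹) :
    ‖∫ x, Complex.exp (Complex.I * (gdPhase n κ x : ℂ)) * b x‖ ≤ 300 * K / √n := by
  have hK : 0 ≤ K := by simpa using (norm_nonneg _).trans (hb'K 0)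
  have ht0 : 0 < t := by linarith
  have hn0 : 0 < n := by linarith
  have hs0 : 0 < √t := sqrt_pos.2 ht0
  have hs : √t ^ 2 = t := sq_sqrt ht0.le
  obtain ⟨iv, -⟩ := integrable_sqrt_inv_cosh
  obtain ⟨iW, bW⟩ := integrable_sinh_div_cosh_sq_weight hn0.le hs0 (-(t / 2))
  obtain ⟨iE, bE⟩ := integrable_exp_neg_abs_abs_sub (log (4 * n / t))
  rw [hs] at iW bW
  have hW : ∀ x, |n * sinh x / cosh x ^ 2 / ((n * (cosh x)⁻¹ + -(t / 2)) ^ 2 + t)| =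
      |n * sinh x / cosh x ^ 2| / ((n * (cosh x)⁻¹ + -(t / 2)) ^ 2 + t) := fun x => by
    rw [abs_div, abs_of_pos (show 0 < (n * (cosh x)⁻¹ + -(t / 2)) ^ 2 + t by positivity)]
  simp only [hW] at iW bW
  have cb : Continuous b := continuous_iff_continuousAt.2 fun x => (hb x).continuousAt
  have ib : Integrable b := by
    refine (iv.const_mul K).mono' cb.aestronglyMeasurable
      (Filter.Eventually.of_forall fun x => (hbK x).trans ?_)
    have hth1 : |sinh x| / cosh x ≤ 1 := by
      rw [div_le_one (cosh_pos x), ← cosh_abs, abs_sinh]; exact (sinh_lt_cosh _).le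
    exact mul_le_mul_of_nonneg_left (mul_le_of_le_one_right (sqrt_nonneg _) hth1) hK
  have iD := (((iE.const_mul 24).add (iW.const_mul (3 * √t))).div_const √n).const_mul K
  refine (norm_integral_gdPhase_le hs0 hb ib iD fun x => ?_).trans ?_
  · rw [hs]
    have h := mul_le_mul_of_nonneg_left (gdPhase_weight_le (x := x) ht hn hκ) hK
    refine le_trans ?_ h
    have hc := cosh_pos x
    calc _ ≤ K * (√(cosh x)⁻¹ * (|sinh x| / cosh x)) * (t / ((n * (cosh x)⁻¹ + κ) ^ 2 + t)) +
        K * √(cosh x)⁻¹ * (|n * (cosh x)⁻¹ + κ| / ((n * (cosh x)⁻¹ + κ) ^ 2 + t)) +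
        K * (√(cosh x)⁻¹ * (|sinh x| / cosh x)) *
          (|n * sinh x / cosh x ^ 2| / ((n * (cosh x)⁻¹ + κ) ^ 2 + t)) := by
          gcongr
          · exact hbK x
          · exact hb'K x
          · exact hbK x
      _ = _ := by ring
  · simp only [Pi.add_apply]
    rw [integral_const_mul, integral_div, integral_add (iE.const_mul _) (iW.const_mul _),
      integral_const_mul, integral_const_mul]
    have hpi := pi_lt_four
    calc _ ≤ K * ((24 * 8 + 3 * √t * (2 * 4 / √t)) / √n) := by
          gcongr
          refine bW.trans ?_
          gcongr
      _ = 216 * K / √n := by field_simp; norm_num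
      _ ≤ 300 * K / √n := by gcongr; norm_num

theorem hasDerivAt_inv_sqrt_one_add_sq (z : ℝ) :
    HasDerivAt (fun z : ℝ => (√(1 + z ^ 2))⁻¹) (-(z * (√(1 + z ^ 2))⁻¹ ^ 3)) z := by
  have h0 : 0 < 1 + z ^ 2 := by positivity
  have hs : √(1 + z ^ 2) ≠ 0 := (sqrt_pos.2 h0).ne'
  have h1 : HasDerivAt (fun z : ℝ => 1 + z ^ 2) (2 * z) z :=
    (((hasDerivAt_id z).pow 2).const_add 1).congr_deriv (by simp)
  refine ((h1.sqrt h0.ne').inv hs).congr_deriv ?_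
  field_simp

theorem abs_mul_inv_sqrt_one_add_sq_le (z : ℝ) : |z * (√(1 + z ^ 2))⁻¹| ≤ 1 := by
  have h0 : 0 < 1 + z ^ 2 := by positivity
  rw [abs_mul, abs_inv, abs_of_pos (sqrt_pos.2 h0), ← div_eq_mul_inv,
    div_le_one (sqrt_pos.2 h0), ← sqrt_sq_eq_abs]
  exact sqrt_le_sqrt (by linarith)

/-- `exp (2 δ arsinh z) / √(1 + z²)`. -/
noncomputable def arsinhWeight (δ : ℂ) (z : ℝ) : ℂ :=
  Complex.exp (2 * δ * (arsinh z : ℂ)) * (((√(1 + z ^ 2))⁻¹ : ℝ) : ℂ)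

/-- The derivative of `arsinhWeight δ`. -/
noncomputable def arsinhWeightDeriv (δ : ℂ) (z : ℝ) : ℂ :=
  Complex.exp (2 * δ * (arsinh z : ℂ)) *
    (2 * δ * (((√(1 + z ^ 2))⁻¹ : ℝ) : ℂ) ^ 2 - (z : ℂ) * (((√(1 + z ^ 2))⁻¹ : ℝ) : ℂ) ^ 3)

/-- The second derivative of `arsinhWeight δ`. -/
noncomputable def arsinhWeightDerivTwo (δ : ℂ) (z : ℝ) : ℂ :=
  Complex.exp (2 * δ * (arsinh z : ℂ)) *
    (4 * δ ^ 2 * (((√(1 + z ^ 2))⁻¹ : ℝ) : ℂ) ^ 3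
      - 6 * δ * (z : ℂ) * (((√(1 + z ^ 2))⁻¹ : ℝ) : ℂ) ^ 4
      - (((√(1 + z ^ 2))⁻¹ : ℝ) : ℂ) ^ 3
      + 3 * (z : ℂ) ^ 2 * (((√(1 + z ^ 2))⁻¹ : ℝ) : ℂ) ^ 5)

theorem hasDerivAt_exp_mul_arsinh (δ : ℂ) (z : ℝ) :
    HasDerivAt (fun z : ℝ => Complex.exp (2 * δ * (arsinh z : ℂ)))
      (Complex.exp (2 * δ * (arsinh z : ℂ)) * (2 * δ * (((√(1 + z ^ 2))⁻¹ : ℝ) : ℂ))) z :=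
  ((hasDerivAt_arsinh z).ofReal_comp.const_mul (2 * δ)).cexp

theorem hasDerivAt_arsinhWeight (δ : ℂ) (z : ℝ) :
    HasDerivAt (arsinhWeight δ) (arsinhWeightDeriv δ z) z := by
  refine ((hasDerivAt_exp_mul_arsinh δ z).mul
    (hasDerivAt_inv_sqrt_one_add_sq z).ofReal_comp).congr_deriv ?_
  unfold arsinhWeightDeriv
  push_cast
  ring

theorem hasDerivAt_arsinhWeightDeriv (δ : ℂ) (z : ℝ) :
    HasDerivAt (arsinhWeightDeriv δ) (arsinhWeightDerivTwo δ z) z := by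
  have hR := (hasDerivAt_inv_sqrt_one_add_sq z).ofReal_comp
  have hz := (hasDerivAt_id z).ofReal_comp
  refine ((hasDerivAt_exp_mul_arsinh δ z).mul (((hR.pow 2).const_mul (2 * δ)).sub
    (hz.mul (hR.pow 3)))).congr_deriv ?_
  unfold arsinhWeightDerivTwo
  simp
  ring

theorem norm_exp_mul_arsinh {δ : ℂ} (hδ : δ.re = 0) (z : ℝ) :
    ‖Complex.exp (2 * δ * (arsinh z : ℂ))‖ = 1 := by
  simp [Complex.norm_exp, hδ]

theorem norm_arsinhWeight {δ : ℂ} (hδ : δ.re = 0) (z : ℝ) :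
    ‖arsinhWeight δ z‖ = (√(1 + z ^ 2))⁻¹ := by
  rw [arsinhWeight, norm_mul, norm_exp_mul_arsinh hδ, one_mul, Complex.norm_real,
    norm_of_nonneg (by positivity)]

theorem norm_arsinhWeightDeriv_le {δ : ℂ} (hδ : δ.re = 0) (z : ℝ) :
    ‖arsinhWeightDeriv δ z‖ ≤ (2 * ‖δ‖ + 1) * (√(1 + z ^ 2))⁻¹ ^ 2 := by
  have h := abs_mul_inv_sqrt_one_add_sq_le z
  rw [arsinhWeightDeriv, norm_mul, norm_exp_mul_arsinh hδ, one_mul]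
  have hR : 0 ≤ (√(1 + z ^ 2))⁻¹ := by positivity
  generalize (√(1 + z ^ 2))⁻¹ = R at h hR
  have e : 2 * δ * (R : ℂ) ^ 2 - (z : ℂ) * (R : ℂ) ^ 3 =
    2 * δ * ((R ^ 2 : ℝ) : ℂ) - ((z * R : ℝ) : ℂ) * ((R ^ 2 : ℝ) : ℂ) := by push_cast; ring
  rw [e]
  refine (norm_sub_le _ _).trans ?_
  rw [norm_mul, norm_mul, norm_mul, Complex.norm_real, Complex.norm_real, norm_eq_abs,
    norm_eq_abs, abs_of_nonneg (pow_nonneg hR 2), RCLike.norm_ofNat, add_mul]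
  gcongr

theorem norm_arsinhWeightDerivTwo_le {δ : ℂ} (hδ : δ.re = 0) (z : ℝ) :
    ‖arsinhWeightDerivTwo δ z‖ ≤ (4 * ‖δ‖ ^ 2 + 6 * ‖δ‖ + 4) * (√(1 + z ^ 2))⁻¹ ^ 3 := by
  have h := abs_mul_inv_sqrt_one_add_sq_le z
  rw [arsinhWeightDerivTwo, norm_mul, norm_exp_mul_arsinh hδ, one_mul]
  have hR : 0 ≤ (√(1 + z ^ 2))⁻¹ := by positivity
  generalize (√(1 + z ^ 2))⁻¹ = R at h hR
  have e : 4 * δ ^ 2 * (R : ℂ) ^ 3 - 6 * δ * (z : ℂ) * (R : ℂ) ^ 4 - (R : ℂ) ^ 3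
      + 3 * (z : ℂ) ^ 2 * (R : ℂ) ^ 5 =
    (4 * δ ^ 2 - 6 * δ * ((z * R : ℝ) : ℂ) - 1 + 3 * ((z * R : ℝ) : ℂ) ^ 2) *
      ((R ^ 3 : ℝ) : ℂ) := by push_cast; ring
  rw [e, norm_mul, Complex.norm_real, norm_eq_abs, abs_of_nonneg (pow_nonneg hR 3)]
  gcongr
  have h1 : ‖((z * R : ℝ) : ℂ)‖ ≤ 1 := by rwa [Complex.norm_real]
  generalize ((z * R : ℝ) : ℂ) = w at h1
  calc _ ≤ ‖4 * δ ^ 2‖ + ‖6 * δ * w‖ + ‖(1 : ℂ)‖ + ‖3 * w ^ 2‖ :=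
        (norm_add_le _ _).trans (add_le_add_left ((norm_sub_le _ _).trans
          (add_le_add_left (norm_sub_le _ _) _)) _)
    _ = 4 * ‖δ‖ ^ 2 + 6 * ‖δ‖ * ‖w‖ + 1 + 3 * ‖w‖ ^ 2 := by simp
    _ ≤ 4 * ‖δ‖ ^ 2 + 6 * ‖δ‖ * 1 + 1 + 3 * 1 ^ 2 := by gcongr
    _ = _ := by ring

theorem inv_sqrt_one_add_sq_sq (z : ℝ) : (√(1 + z ^ 2))⁻¹ ^ 2 = (1 + z ^ 2)⁻¹ := by
  rw [inv_pow, sq_sqrt (by positivity)]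

theorem hasDerivAt_smul_arsinhWeightDeriv (δ : ℂ) (z : ℝ) :
    HasDerivAt (fun z : ℝ => z • arsinhWeightDeriv δ z)
      (z • arsinhWeightDerivTwo δ z + (1 : ℝ) • arsinhWeightDeriv δ z) z :=
  (hasDerivAt_id z).smul (hasDerivAt_arsinhWeightDeriv δ z)

/-- The constant in the decay estimates for `arsinhWeight` and its derivatives. -/
noncomputable def weightConst (δ : ℂ) : ℝ := 4 * ‖δ‖ ^ 2 + 8 * ‖δ‖ + 5

theorem weightConst_pos (δ : ℂ) : 0 < weightConst δ := by unfold weightConst; positivity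

theorem norm_arsinhWeight_le {δ : ℂ} (hδ : δ.re = 0) (z : ℝ) :
    ‖arsinhWeight δ z‖ ≤ weightConst δ / √(1 + z ^ 2) := by
  rw [norm_arsinhWeight hδ, div_eq_mul_inv]
  refine le_mul_of_one_le_left (by positivity) ?_
  unfold weightConst
  nlinarith [norm_nonneg δ]

theorem norm_arsinhWeightDeriv_le' {δ : ℂ} (hδ : δ.re = 0) (z : ℝ) :
    ‖arsinhWeightDeriv δ z‖ ≤ weightConst δ / (1 + z ^ 2) := by
  refine (norm_arsinhWeightDeriv_le hδ z).trans ?_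
  rw [div_eq_mul_inv, ← inv_sqrt_one_add_sq_sq]
  gcongr
  unfold weightConst
  nlinarith [norm_nonneg δ]

theorem norm_smul_arsinhWeightDeriv_le {δ : ℂ} (hδ : δ.re = 0) (z : ℝ) :
    ‖z • arsinhWeightDeriv δ z‖ ≤ weightConst δ / √(1 + z ^ 2) := by
  have h := abs_mul_inv_sqrt_one_add_sq_le z
  have h2 := norm_arsinhWeightDeriv_le hδ z
  have hR : 0 ≤ (√(1 + z ^ 2))⁻¹ := by positivity
  rw [norm_smul, norm_eq_abs, div_eq_mul_inv]
  rw [abs_mul, abs_of_nonneg hR] at h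
  calc _ ≤ |z| * ((2 * ‖δ‖ + 1) * (√(1 + z ^ 2))⁻¹ ^ 2) := by gcongr
    _ = (|z| * (√(1 + z ^ 2))⁻¹) * ((2 * ‖δ‖ + 1) * (√(1 + z ^ 2))⁻¹) := by ring
    _ ≤ 1 * ((2 * ‖δ‖ + 1) * (√(1 + z ^ 2))⁻¹) := by gcongr
    _ ≤ _ := by
      rw [one_mul]
      gcongr
      unfold weightConst
      nlinarith [norm_nonneg δ]

theorem norm_deriv_smul_arsinhWeightDeriv_le {δ : ℂ} (hδ : δ.re = 0) (z : ℝ) :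
    ‖z • arsinhWeightDerivTwo δ z + (1 : ℝ) • arsinhWeightDeriv δ z‖ ≤
      weightConst δ / (1 + z ^ 2) := by
  have h := abs_mul_inv_sqrt_one_add_sq_le z
  have h2 := norm_arsinhWeightDeriv_le hδ z
  have h3 := norm_arsinhWeightDerivTwo_le hδ z
  have hR : 0 ≤ (√(1 + z ^ 2))⁻¹ := by positivity
  rw [abs_mul, abs_of_nonneg hR] at h
  refine (norm_add_le _ _).trans ?_
  rw [one_smul, norm_smul, norm_eq_abs, div_eq_mul_inv, ← inv_sqrt_one_add_sq_sq]
  have h4 : |z| * ‖arsinhWeightDerivTwo δ z‖ ≤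
      (4 * ‖δ‖ ^ 2 + 6 * ‖δ‖ + 4) * (√(1 + z ^ 2))⁻¹ ^ 2 := by
    calc _ ≤ |z| * ((4 * ‖δ‖ ^ 2 + 6 * ‖δ‖ + 4) * (√(1 + z ^ 2))⁻¹ ^ 3) := by gcongr
      _ = (|z| * (√(1 + z ^ 2))⁻¹) *
          ((4 * ‖δ‖ ^ 2 + 6 * ‖δ‖ + 4) * (√(1 + z ^ 2))⁻¹ ^ 2) := by ring
      _ ≤ 1 * ((4 * ‖δ‖ ^ 2 + 6 * ‖δ‖ + 4) * (√(1 + z ^ 2))⁻¹ ^ 2) := by gcongr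
      _ = _ := one_mul _
  calc _ ≤ _ := add_le_add h4 h2
    _ = _ := by unfold weightConst; ring

theorem continuous_arsinhWeight (δ : ℂ) : Continuous (arsinhWeight δ) :=
  continuous_iff_continuousAt.2 fun z => (hasDerivAt_arsinhWeight δ z).continuousAt

theorem continuous_arsinhWeightDeriv (δ : ℂ) : Continuous (arsinhWeightDeriv δ) :=
  continuous_iff_continuousAt.2 fun z => (hasDerivAt_arsinhWeightDeriv δ z).continuousAt

theorem norm_coshOsc_arsinhWeight_le {δ : ℂ} (hδ : δ.re = 0) {t s : ℝ} (ht : 1 ≤ t) (hs : 0 < s)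
    (hs1 : s ≤ 1) : ‖coshOsc t (arsinhWeight δ) s‖ ≤ 11 * π * weightConst δ / √t :=
  norm_coshOsc_le ht hs hs1 (hasDerivAt_arsinhWeight δ) (norm_arsinhWeight_le hδ)
    (norm_arsinhWeightDeriv_le' hδ)

theorem norm_coshOsc_smul_arsinhWeightDeriv_le {δ : ℂ} (hδ : δ.re = 0) {t s : ℝ} (ht : 1 ≤ t)
    (hs : 0 < s) (hs1 : s ≤ 1) :
    ‖coshOsc t (fun z => z • arsinhWeightDeriv δ z) s‖ ≤ 11 * π * weightConst δ / √t :=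
  norm_coshOsc_le ht hs hs1 (hasDerivAt_smul_arsinhWeightDeriv δ)
    (norm_smul_arsinhWeightDeriv_le hδ) (norm_deriv_smul_arsinhWeightDeriv_le hδ)

theorem hasDerivAt_coshOsc_arsinhWeight {δ : ℂ} (hδ : δ.re = 0) {t s : ℝ} (hs : 0 < s)
    (hs1 : s < 1) : HasDerivAt (coshOsc t (arsinhWeight δ))
      (s⁻¹ • coshOsc t (fun z => z • arsinhWeightDeriv δ z) s) s :=
  hasDerivAt_coshOsc hs hs1 (hasDerivAt_arsinhWeight δ) (norm_arsinhWeight_le hδ)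
    (norm_arsinhWeightDeriv_le' hδ) (continuous_arsinhWeightDeriv δ)

theorem sin_arctan_exp_pos (x : ℝ) : 0 < sin (arctan (exp x)) :=
  sin_pos_of_pos_of_lt_pi (arctan_pos.2 (exp_pos x))
    ((arctan_lt_pi_div_two _).trans (by linarith [pi_pos]))

theorem two_mul_sin_mul_cos_arctan_exp (x : ℝ) :
    2 * (sin (arctan (exp x)) * cos (arctan (exp x))) = (cosh x)⁻¹ := by
  have h := exp_pos x
  have h1 : 0 < 1 + exp x ^ 2 := by positivity
  rw [sin_arctan, cos_arctan, div_mul_div_comm, mul_self_sqrt h1.le, cosh_eq, exp_neg]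
  field_simp
  ring

theorem sin_arctan_exp_lt_one (x : ℝ) : sin (arctan (exp x)) < 1 := by
  have h1 := cos_arctan_pos (exp x)
  have h2 := sin_sq_add_cos_sq (arctan (exp x))
  nlinarith [sin_arctan_exp_pos x]

theorem cos_arctan_exp_lt_one (x : ℝ) : cos (arctan (exp x)) < 1 := by
  have h1 := sin_arctan_exp_pos x
  have h2 := sin_sq_add_cos_sq (arctan (exp x))
  nlinarith [cos_arctan_pos (exp x)]

theorem hasDerivAt_arctan_exp (x : ℝ) :
    HasDerivAt (fun x => arctan (exp x)) (sin (arctan (exp x)) * cos (arctan (exp x))) x := by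
  have h := (hasDerivAt_two_mul_arctan_exp x).const_mul (1 / 2)
  rw [← two_mul_sin_mul_cos_arctan_exp] at h
  simpa using h

theorem hasDerivAt_sin_arctan_exp (x : ℝ) :
    HasDerivAt (fun x => sin (arctan (exp x)))
      (sin (arctan (exp x)) * cos (arctan (exp x)) ^ 2) x :=
  (hasDerivAt_arctan_exp x).sin.congr_deriv (by ring)

theorem hasDerivAt_cos_arctan_exp (x : ℝ) :
    HasDerivAt (fun x => cos (arctan (exp x)))
      (cos (arctan (exp x)) * -(sin (arctan (exp x)) ^ 2)) x :=
  (hasDerivAt_arctan_exp x).cos.congr_deriv (by ring)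

theorem hasDerivAt_coshOsc_comp {δ : ℂ} (hδ : δ.re = 0) {t x a : ℝ} {σ : ℝ → ℝ} (hs : 0 < σ x)
    (hs1 : σ x < 1) (hσ : HasDerivAt σ (σ x * a) x) :
    HasDerivAt (fun x => coshOsc t (arsinhWeight δ) (σ x))
      (a • coshOsc t (fun z => z • arsinhWeightDeriv δ z) (σ x)) x := by
  refine ((hasDerivAt_coshOsc_arsinhWeight hδ hs hs1).scomp x hσ).congr_deriv ?_
  rw [smul_smul]
  congr 1
  field_simp

theorem norm_smul_coshOsc_le {δ : ℂ} (hδ : δ.re = 0) {t s a : ℝ} (ht : 1 ≤ t)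
    (hs : 0 < s) (hs1 : s ≤ 1) (ha : |a| ≤ 1) :
    ‖a • coshOsc t (fun z => z • arsinhWeightDeriv δ z) s‖ ≤ 11 * π * weightConst δ / √t := by
  rw [norm_smul]
  refine le_trans ?_ (norm_coshOsc_smul_arsinhWeightDeriv_le hδ ht hs hs1)
  exact mul_le_of_le_one_left (norm_nonneg _) ha

theorem hasDerivAt_tanh (x : ℝ) : HasDerivAt tanh (1 / cosh x ^ 2) x := by
  have h := (hasDerivAt_sinh x).div (hasDerivAt_cosh x) (cosh_pos x).ne'
  have e : tanh = fun x => sinh x / cosh x := funext tanh_eq_sinh_div_cosh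
  rw [e]
  refine h.congr_deriv ?_
  rw [← sq, ← sq, cosh_sq]
  ring

theorem one_sub_sq_mul_tanh {θ : ℝ} (x : ℝ) :
    1 - (sin θ * tanh x) ^ 2 = (√(1 + (cos θ * sinh x) ^ 2) / cosh x) ^ 2 := by
  have hc := (cosh_pos x).ne'
  rw [div_pow, sq_sqrt (by positivity), tanh_eq_sinh_div_cosh]
  field_simp
  rw [cosh_sq]
  linear_combination (-sinh x ^ 2) * sin_sq_add_cos_sq θ

/-- The change of variables `sin η = sin θ tanh ξ`. -/
noncomputable def arcsinTanh (θ ξ : ℝ) : ℝ := arcsin (sin θ * tanh ξ)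

theorem abs_sin_mul_tanh_lt_one (θ ξ : ℝ) : |sin θ * tanh ξ| < 1 := by
  rw [abs_mul]
  have h1 := abs_sin_le_one θ
  have h2 : |tanh ξ| < 1 := abs_lt.2 ⟨neg_one_lt_tanh ξ, tanh_lt_one ξ⟩
  nlinarith [abs_nonneg (tanh ξ)]

theorem sin_arcsinTanh (θ ξ : ℝ) : sin (arcsinTanh θ ξ) = sin θ * tanh ξ := by
  have h := abs_lt.1 (abs_sin_mul_tanh_lt_one θ ξ)
  exact sin_arcsin h.1.le h.2.le

theorem cos_arcsinTanh (θ ξ : ℝ) :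
    cos (arcsinTanh θ ξ) = √(1 + (cos θ * sinh ξ) ^ 2) / cosh ξ := by
  have hc := cosh_pos ξ
  rw [arcsinTanh, cos_arcsin, one_sub_sq_mul_tanh, sqrt_sq (by positivity)]

theorem hasDerivAt_arcsinTanh (θ ξ : ℝ) :
    HasDerivAt (arcsinTanh θ) (sin θ / (cosh ξ * √(1 + (cos θ * sinh ξ) ^ 2))) ξ := by
  have hc := cosh_pos ξ
  have h := abs_lt.1 (abs_sin_mul_tanh_lt_one θ ξ)
  refine ((hasDerivAt_arcsin h.1.ne' h.2.ne).comp ξ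
    ((hasDerivAt_tanh ξ).const_mul (sin θ))).congr_deriv ?_
  rw [one_sub_sq_mul_tanh, sqrt_sq (by positivity)]
  have : 0 < √(1 + (cos θ * sinh ξ) ^ 2) := sqrt_pos.2 (by positivity)
  field_simp

theorem exp_neg_arsinh (z : ℝ) : exp (-arsinh z) = √(1 + z ^ 2) - z := by
  rw [← arsinh_neg, exp_arsinh, neg_sq]
  ring

theorem sin_add_arcsinTanh (θ ξ : ℝ) :
    sin (θ + arcsinTanh θ ξ) = sin θ * exp (arsinh (cos θ * sinh ξ)) / cosh ξ := by
  rw [sin_add, sin_arcsinTanh, cos_arcsinTanh, exp_arsinh, tanh_eq_sinh_div_cosh]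
  ring

theorem sin_sub_arcsinTanh (θ ξ : ℝ) :
    sin (θ - arcsinTanh θ ξ) = sin θ * exp (-arsinh (cos θ * sinh ξ)) / cosh ξ := by
  rw [sin_sub, sin_arcsinTanh, cos_arcsinTanh, exp_neg_arsinh, tanh_eq_sinh_div_cosh]
  ring

theorem injective_arcsinTanh {θ : ℝ} (h0 : 0 < θ) (h1 : θ < π / 2) :
    Function.Injective (arcsinTanh θ) := by
  have hs : 0 < sin θ := sin_pos_of_pos_of_lt_pi h0 (by linarith [pi_pos])
  intro x y h
  have := congrArg sin h
  rw [sin_arcsinTanh, sin_arcsinTanh] at this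
  exact tanh_injective (mul_left_cancel₀ hs.ne' this)

theorem image_arcsinTanh {θ : ℝ} (h0 : 0 < θ) (h1 : θ < π / 2) :
    arcsinTanh θ '' Set.univ = Set.Ioo (-θ) θ := by
  have hs : 0 < sin θ := sin_pos_of_pos_of_lt_pi h0 (by linarith [pi_pos])
  ext η
  constructor
  · rintro ⟨ξ, -, rfl⟩
    have h2 := tanh_lt_one ξ
    have h3 := neg_one_lt_tanh ξ
    have hm : arcsinTanh θ ξ ∈ Set.Icc (-(π / 2)) (π / 2) := arcsin_mem_Icc _
    constructor
    · refine (strictMonoOn_sin.lt_iff_lt ⟨by linarith, by linarith⟩ hm).1 ?_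
      rw [sin_arcsinTanh, sin_neg]
      nlinarith
    · refine (strictMonoOn_sin.lt_iff_lt hm ⟨by linarith, by linarith⟩).1 ?_
      rw [sin_arcsinTanh]
      nlinarith
  · rintro ⟨h2, h3⟩
    have h4 : sin η < sin θ :=
      strictMonoOn_sin ⟨by linarith, by linarith⟩ ⟨by linarith, by linarith⟩ h3
    have h5 : sin (-θ) < sin η :=
      strictMonoOn_sin ⟨by linarith, by linarith⟩ ⟨by linarith, by linarith⟩ h2
    rw [sin_neg] at h5
    refine ⟨artanh (sin η / sin θ), trivial, ?_⟩
    have hm : sin η / sin θ ∈ Set.Ioo (-1) 1 :=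
      ⟨by rw [lt_div_iff₀ hs]; linarith, by rw [div_lt_one hs]; exact h4⟩
    rw [arcsinTanh, tanh_artanh hm, mul_div_cancel₀ _ hs.ne']
    exact arcsin_sin (by linarith) (by linarith)

theorem arcsinTanh_pullback {θ : ℝ} (h0 : 0 < θ) (h1 : θ < π / 2) (δ : ℂ) (t ξ : ℝ) :
    |sin θ / (cosh ξ * √(1 + (cos θ * sinh ξ) ^ 2))| •
      (pw (sin (θ + arcsinTanh θ ξ)) (δ + (-(Complex.I * t) - 1) / 2) *
        pw (sin (θ - arcsinTanh θ ξ)) (-δ + (-(Complex.I * t) - 1) / 2)) =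
    pw (sin θ) (-(Complex.I * t)) * (Complex.exp (Complex.I * ((t * log (cosh ξ) : ℝ) : ℂ)) *
      arsinhWeight δ (cos θ * sinh ξ)) := by
  have hs : 0 < sin θ := sin_pos_of_pos_of_lt_pi h0 (by linarith [pi_pos])
  have hc := cosh_pos ξ
  have hS : 0 < √(1 + (cos θ * sinh ξ) ^ 2) := sqrt_pos.2 (by positivity)
  rw [sin_add_arcsinTanh, sin_sub_arcsinTanh, abs_of_pos (by positivity), arsinhWeight]
  simp only [pw]
  rw [log_div (by positivity) hc.ne', log_div (by positivity) hc.ne', log_mul hs.ne' (exp_ne_zero _),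
    log_mul hs.ne' (exp_ne_zero _), log_exp, log_exp, Complex.real_smul]
  have e : sin θ / (cosh ξ * √(1 + (cos θ * sinh ξ) ^ 2)) =
      exp (log (sin θ) - log (cosh ξ)) * (√(1 + (cos θ * sinh ξ) ^ 2))⁻¹ := by
    rw [exp_sub, exp_log hs, exp_log hc]
    field_simp
  rw [e, Complex.ofReal_mul, Complex.ofReal_exp]
  generalize (√(1 + (cos θ * sinh ξ) ^ 2))⁻¹ = R
  have : ∀ a b c d e f : ℂ, a + b + c = d + e + f →
      Complex.exp a * R * (Complex.exp b * Complex.exp c) =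
        Complex.exp d * (Complex.exp e * (Complex.exp f * R)) := by
    intro a b c d e f h
    have := congrArg Complex.exp h
    simp only [Complex.exp_add] at this
    linear_combination (R : ℂ) * this
  refine this _ _ _ _ _ _ ?_
  push_cast
  ring

theorem integral_sin_pw {θ : ℝ} (h0 : 0 < θ) (h1 : θ < π / 2) {δ : ℂ} (hδ : δ.re = 0) (t : ℝ) :
    IntervalIntegrable (fun η => pw (sin (θ + η)) (δ + (-(Complex.I * t) - 1) / 2) *
        pw (sin (θ - η)) (-δ + (-(Complex.I * t) - 1) / 2)) volume (-θ) θ ∧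
    ∫ η in (-θ)..θ, pw (sin (θ + η)) (δ + (-(Complex.I * t) - 1) / 2) *
        pw (sin (θ - η)) (-δ + (-(Complex.I * t) - 1) / 2) =
      pw (sin θ) (-(Complex.I * t)) * coshOsc t (arsinhWeight δ) (cos θ) := by
  have hcos : 0 < cos θ := cos_pos_of_mem_Ioo ⟨by linarith, h1⟩
  have hd : ∀ x ∈ Set.univ, HasDerivWithinAt (arcsinTanh θ) _ Set.univ x := fun x _ =>
    (hasDerivAt_arcsinTanh θ x).hasDerivWithinAt
  have hinj : Set.InjOn (arcsinTanh θ) Set.univ := (injective_arcsinTanh h0 h1).injOn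
  have hle : -θ ≤ θ := by linarith
  constructor
  · rw [intervalIntegrable_iff_integrableOn_Ioo_of_le hle, ← image_arcsinTanh h0 h1,
      integrableOn_image_iff_integrableOn_abs_deriv_smul MeasurableSet.univ hd hinj]
    simp only [arcsinTanh_pullback h0 h1, integrableOn_univ]
    refine Integrable.const_mul ?_ _
    refine (integrable_comp_mul_sinh (continuous_arsinhWeight δ) (norm_arsinhWeight_le hδ) hcos
      (cos_le_one θ)).bdd_mul (c := 1) ?_ (Filter.Eventually.of_forall fun x => ?_)
    · have : Continuous fun x : ℝ => log (cosh x) :=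
        continuous_cosh.log fun x => (cosh_pos x).ne'
      exact Continuous.aestronglyMeasurable (by fun_prop)
    · simp [Complex.norm_exp]
  · rw [intervalIntegral.integral_of_le hle, integral_Ioc_eq_integral_Ioo,
      ← image_arcsinTanh h0 h1,
      integral_image_eq_integral_abs_deriv_smul MeasurableSet.univ hd hinj]
    simp only [arcsinTanh_pullback h0 h1, setIntegral_univ]
    rw [integral_const_mul, coshOsc]

theorem periodic_abs_sin_pw (α β : ℂ) (c : ℝ) :
    Function.Periodic (fun y => pw |sin (y + c)| α * pw |sin y| β) π := by
  intro y
  simp only [show y + π + c = y + c + π by ring, sin_add_pi, abs_neg]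

theorem integral_zero_two_pi_of_periodic {f : ℝ → ℂ} (hf : Function.Periodic f π) {a : ℝ}
    (hi : IntervalIntegrable f volume a (a + π)) :
    ∫ x in (0 : ℝ)..(2 * π), f x = 2 * ∫ x in a..(a + π), f x := by
  have h := hf.intervalIntegrable pi_ne_zero hi
  have h2 := hf.intervalIntegral_add_eq_add 0 π h
  rw [← two_mul] at h2
  have h3 := hf.intervalIntegral_add_eq 0 a
  rw [h2, ← h3, zero_add, two_mul]

theorem integral_abs_sin_pw {c : ℝ} (hc0 : 0 < c) (hc1 : c < π) {δ : ℂ} (hδ : δ.re = 0) (t : ℝ) :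
    ∫ y in (0 : ℝ)..(2 * π), pw |sin (y + c)| (δ + (-(Complex.I * t) - 1) / 2) *
        pw |sin y| (-δ + (-(Complex.I * t) - 1) / 2) =
      2 * (pw (sin (c / 2)) (-(Complex.I * t)) * coshOsc t (arsinhWeight δ) (cos (c / 2)) +
        pw (cos (c / 2)) (-(Complex.I * t)) * coshOsc t (arsinhWeight δ) (sin (c / 2))) := by
  set α := δ + (-(Complex.I * t) - 1) / 2
  set β := -δ + (-(Complex.I * t) - 1) / 2
  set f : ℝ → ℂ := fun y => pw |sin (y + c)| α * pw |sin y| β with hf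
  obtain ⟨i1, e1⟩ := integral_sin_pw (θ := c / 2) (by linarith) (by linarith) hδ t
  obtain ⟨i2, e2⟩ := integral_sin_pw (θ := π / 2 - c / 2) (by linarith) (by linarith) hδ t
  rw [cos_pi_div_two_sub, sin_pi_div_two_sub] at e2
  have c1 : Set.EqOn (fun η => pw (sin (c / 2 + η)) α * pw (sin (c / 2 - η)) β)
      (fun η => f (η - c / 2)) (Set.uIcc (-(c / 2)) (c / 2)) := by
    intro η hη
    rw [Set.uIcc_of_le (by linarith)] at hη
    obtain ⟨h1, h2⟩ := hη
    have s1 : 0 ≤ sin (c / 2 + η) := sin_nonneg_of_nonneg_of_le_pi (by linarith) (by linarith)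
    have s2 : 0 ≤ sin (c / 2 - η) := sin_nonneg_of_nonneg_of_le_pi (by linarith) (by linarith)
    simp only [hf]
    rw [show η - c / 2 + c = c / 2 + η by ring, ← neg_sub (c / 2) η, sin_neg, abs_neg,
      abs_of_nonneg s1, abs_of_nonneg s2]
  have c2 : Set.EqOn (fun η => pw (sin (π / 2 - c / 2 + η)) α * pw (sin (π / 2 - c / 2 - η)) β)
      (fun η => f (π / 2 - c / 2 - η)) (Set.uIcc (-(π / 2 - c / 2)) (π / 2 - c / 2)) := by
    intro η hη
    rw [Set.uIcc_of_le (by linarith)] at hη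
    obtain ⟨h1, h2⟩ := hη
    have s1 : 0 ≤ sin (π / 2 - c / 2 + η) :=
      sin_nonneg_of_nonneg_of_le_pi (by linarith) (by linarith)
    have s2 : 0 ≤ sin (π / 2 - c / 2 - η) :=
      sin_nonneg_of_nonneg_of_le_pi (by linarith) (by linarith)
    simp only [hf]
    rw [show π / 2 - c / 2 - η + c = π - (π / 2 - c / 2 + η) by ring, sin_pi_sub,
      abs_of_nonneg s1, abs_of_nonneg s2]
  have j1 : IntervalIntegrable f volume (-c) 0 := by
    have := (i1.congr (c1.mono Set.uIoc_subset_uIcc)).comp_add_right (c / 2)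
    simp only [add_sub_cancel_right, sub_self] at this
    rwa [show -(c / 2) - c / 2 = -c by ring] at this
  have j2 : IntervalIntegrable f volume 0 (π - c) := by
    have := ((i2.congr (c2.mono Set.uIoc_subset_uIcc)).comp_sub_left (π / 2 - c / 2)).symm
    simp only [sub_sub_cancel, sub_self, sub_neg_eq_add] at this
    rwa [show π / 2 - c / 2 + (π / 2 - c / 2) = π - c by ring] at this
  have d1 : ∫ y in (-c)..0, f y =
      pw (sin (c / 2)) (-(Complex.I * t)) * coshOsc t (arsinhWeight δ) (cos (c / 2)) := by
    rw [← e1, intervalIntegral.integral_congr c1, intervalIntegral.integral_comp_sub_right]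
    congr 1 <;> ring
  have d2 : ∫ y in (0 : ℝ)..(π - c), f y =
      pw (cos (c / 2)) (-(Complex.I * t)) * coshOsc t (arsinhWeight δ) (sin (c / 2)) := by
    rw [← e2, intervalIntegral.integral_congr c2, intervalIntegral.integral_comp_sub_left]
    congr 1 <;> ring
  have j : IntervalIntegrable f volume (-c) (-c + π) := by
    rw [neg_add_eq_sub]; exact j1.trans j2
  rw [integral_zero_two_pi_of_periodic (periodic_abs_sin_pw α β c) j, neg_add_eq_sub,
    ← intervalIntegral.integral_add_adjacent_intervals j1 j2, d1, d2]

theorem lker_eq {τ τ' : ℂ} (hτ : τ.re = 0) (hτ' : τ'.re = 0) (t : ℝ) {c : ℝ} (hc0 : 0 < c)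
    (hc1 : c < π) :
    lker τ τ' (Complex.I * t) c = 1 / π * (pw (sin c) ((-τ - τ' + Complex.I * t - 1) / 2) *
      (pw (sin (c / 2)) (-(Complex.I * t)) *
          coshOsc t (arsinhWeight ((τ' - τ) / 2)) (cos (c / 2)) +
        pw (cos (c / 2)) (-(Complex.I * t)) *
          coshOsc t (arsinhWeight ((τ' - τ) / 2)) (sin (c / 2)))) := by
  have hδ : ((τ' - τ) / 2).re = 0 := by simp [hτ, hτ']
  have h := integral_abs_sin_pw hc0 hc1 hδ t
  have e1 : (τ' - τ) / 2 + (-(Complex.I * t) - 1) / 2 = (-τ + τ' - Complex.I * t - 1) / 2 := by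
    ring
  have e2 : -((τ' - τ) / 2) + (-(Complex.I * t) - 1) / 2 = (τ - τ' - Complex.I * t - 1) / 2 := by
    ring
  rw [e1, e2] at h
  have hK : ∀ y : ℝ, Kker τ τ' (Complex.I * t) (y + c) y 0 =
      pw (sin c) ((-τ - τ' + Complex.I * t - 1) / 2) *
        (pw |sin (y + c)| ((-τ + τ' - Complex.I * t - 1) / 2) *
          pw |sin y| ((τ - τ' - Complex.I * t - 1) / 2)) := by
    intro y
    rw [Kker, add_sub_cancel_left, sub_zero, sub_zero,
      abs_of_pos (sin_pos_of_pos_of_lt_pi hc0 hc1), mul_assoc]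
  rw [lker]
  simp only [hK]
  rw [intervalIntegral.integral_const_mul, h]
  have : (π : ℂ) ≠ 0 := Complex.ofReal_ne_zero.2 pi_ne_zero
  field_simp

theorem periodic_lker (τ τ' lam : ℂ) : Function.Periodic (lker τ τ' lam) π := by
  intro c
  have e : ∀ y : ℝ, y + c + π - y = c + π := fun y => by ring
  simp only [lker, Kker, sub_zero, add_sub_cancel_left, ← add_assoc, e, sin_add_pi, abs_neg]

theorem log_sin_arctan_exp (x : ℝ) :
    log (sin (arctan (exp x))) = (x + log (cosh x)⁻¹ - log 2) / 2 := by
  have hs := sin_arctan_exp_pos x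
  have hc := cos_arctan_pos (exp x)
  have h1 : sin (arctan (exp x)) = exp x * cos (arctan (exp x)) := by
    rw [sin_arctan, cos_arctan]; ring
  rw [← two_mul_sin_mul_cos_arctan_exp, log_mul two_ne_zero (by positivity),
    log_mul hs.ne' hc.ne']
  have h2 := congrArg log h1
  rw [log_mul (exp_ne_zero x) hc.ne', log_exp] at h2
  linarith

theorem log_cos_arctan_exp (x : ℝ) :
    log (cos (arctan (exp x))) = (-x + log (cosh x)⁻¹ - log 2) / 2 := by
  have h := log_sin_arctan_exp x
  have hs := sin_arctan_exp_pos x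
  have hc := cos_arctan_pos (exp x)
  have h2 := congrArg log (two_mul_sin_mul_cos_arctan_exp x)
  rw [log_mul two_ne_zero (by positivity), log_mul hs.ne' hc.ne'] at h2
  linarith

/-- The complex power `(cosh x)^{-z}`. -/
noncomputable def coshPow (z : ℂ) (x : ℝ) : ℂ := pw (cosh x)⁻¹ z

theorem norm_coshPow {z : ℂ} (hz : z.re = 1 / 2) (x : ℝ) : ‖coshPow z x‖ = √(cosh x)⁻¹ := by
  have hc := inv_pos.2 (cosh_pos x)
  rw [coshPow, pw, Complex.norm_exp, Complex.re_mul_ofReal, hz, sqrt_eq_rpow,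
    rpow_def_of_pos hc, mul_comm]

theorem hasDerivAt_coshPow (z : ℂ) (x : ℝ) :
    HasDerivAt (coshPow z) (coshPow z x * (z * ((-(sinh x / cosh x) : ℝ) : ℂ))) x := by
  have hc := cosh_pos x
  have h : HasDerivAt (fun x => log (cosh x)⁻¹) (-(sinh x / cosh x)) x := by
    refine (((hasDerivAt_cosh x).inv hc.ne').log (inv_ne_zero hc.ne')).congr_deriv ?_
    rw [Pi.inv_apply]
    field_simp
  exact (h.ofReal_comp.const_mul z).cexp

theorem abs_sinh_div_cosh_le (x : ℝ) : |sinh x| / cosh x ≤ 1 := by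
  rw [div_le_one (cosh_pos x), ← cosh_abs, abs_sinh]
  exact (sinh_lt_cosh _).le

theorem norm_coshPow_deriv_le {z : ℂ} (hz : z.re = 1 / 2) (x : ℝ) :
    ‖coshPow z x * (z * ((-(sinh x / cosh x) : ℝ) : ℂ))‖ ≤ ‖z‖ * √(cosh x)⁻¹ := by
  rw [norm_mul, norm_coshPow hz, norm_mul, Complex.norm_real, norm_neg, norm_div, norm_eq_abs,
    norm_eq_abs, abs_of_pos (cosh_pos x), mul_comm]
  have := abs_sinh_div_cosh_le x
  gcongr
  exact mul_le_of_le_one_right (norm_nonneg _) this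

theorem image_two_mul_arctan_exp :
    (fun x => 2 * arctan (exp x)) '' Set.univ = Set.Ioo 0 π := by
  ext c
  constructor
  · rintro ⟨x, -, rfl⟩
    have h1 := arctan_pos.2 (exp_pos x)
    have h2 := arctan_lt_pi_div_two (exp x)
    exact ⟨by positivity, by dsimp only; linarith⟩
  · rintro ⟨h1, h2⟩
    have ht : 0 < tan (c / 2) := tan_pos_of_pos_of_lt_pi_div_two (by linarith) (by linarith)
    refine ⟨log (tan (c / 2)), trivial, ?_⟩
    dsimp only
    rw [exp_log ht, arctan_tan (by linarith) (by linarith)]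
    ring

theorem injective_two_mul_arctan_exp : Function.Injective fun x => 2 * arctan (exp x) := by
  intro x y h
  exact exp_injective (arctan_injective (mul_left_cancel₀ two_ne_zero h))

theorem outer_pullback {τ τ' : ℂ} (hτ : τ.re = 0) (hτ' : τ'.re = 0) (t : ℝ) (n : ℤ)
    (φ : ℝ → ℂ) (x : ℝ) :
    |(cosh x)⁻¹| • (lker τ τ' (Complex.I * t) (2 * arctan (exp x)) *
        Complex.exp (Complex.I * (n : ℂ) * ((2 * arctan (exp x) : ℝ) : ℂ)) *
        φ (2 * arctan (exp x))) =
      1 / π * Complex.exp (Complex.I * t / 2 * (log 2 : ℝ)) *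
      (Complex.exp (Complex.I * (gdPhase n (-(t / 2)) x : ℂ)) *
          (coshOsc t (arsinhWeight ((τ' - τ) / 2)) (cos (arctan (exp x))) *
            (coshPow ((1 - τ - τ') / 2) x * φ (2 * arctan (exp x)))) +
        Complex.exp (Complex.I * (gdPhase n (t / 2) x : ℂ)) *
          (coshOsc t (arsinhWeight ((τ' - τ) / 2)) (sin (arctan (exp x))) *
            (coshPow ((1 - τ - τ') / 2) x * φ (2 * arctan (exp x))))) := by
  have h1 := arctan_pos.2 (exp_pos x)
  have h2 := arctan_lt_pi_div_two (exp x)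
  have hu := inv_pos.2 (cosh_pos x)
  have eu : (((cosh x)⁻¹ : ℝ) : ℂ) = Complex.exp (log (cosh x)⁻¹ : ℝ) := by
    rw [← Complex.ofReal_exp, exp_log hu]
  rw [lker_eq hτ hτ' t (by positivity) (by linarith), mul_div_cancel_left₀ _ (two_ne_zero' ℝ),
    sin_two_mul, mul_assoc 2, two_mul_sin_mul_cos_arctan_exp, abs_of_pos hu, Complex.real_smul,
    eu, coshPow]
  simp only [pw, gdPhase]
  rw [log_sin_arctan_exp, log_cos_arctan_exp]
  generalize log (cosh x)⁻¹ = u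
  generalize coshOsc t (arsinhWeight ((τ' - τ) / 2)) (cos (arctan (exp x))) = N1
  generalize coshOsc t (arsinhWeight ((τ' - τ) / 2)) (sin (arctan (exp x))) = N2
  generalize φ (2 * arctan (exp x)) = p
  generalize arctan (exp x) = θ
  have key : ∀ a b c c' d e f f' g : ℂ, a + b + c + d = e + f + g →
      a + b + c' + d = e + f' + g →
      Complex.exp a * (1 / π * (Complex.exp b * (Complex.exp c * N1 + Complex.exp c' * N2)) *
        Complex.exp d * p) = 1 / π * Complex.exp e * (Complex.exp f * (N1 * (Complex.exp g * p)) +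
          Complex.exp f' * (N2 * (Complex.exp g * p))) := by
    intro a b c c' d e f f' g h h'
    have h := congrArg Complex.exp h
    have h' := congrArg Complex.exp h'
    simp only [Complex.exp_add] at h h'
    linear_combination (1 / π * N1 * p) * h + (1 / π * N2 * p) * h'
  refine key _ _ _ _ _ _ _ _ _ ?_ ?_
  · push_cast; ring
  · push_cast; ring

theorem Ffun_eq {τ τ' : ℂ} (hτ : τ.re = 0) (hτ' : τ'.re = 0) {t : ℝ} {n : ℤ} (hn : Even n)
    {φ : ℝ → ℂ} (hφ : Function.Periodic φ π)
    (i1 : Integrable fun x => coshOsc t (arsinhWeight ((τ' - τ) / 2)) (cos (arctan (exp x))) *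
      (coshPow ((1 - τ - τ') / 2) x * φ (2 * arctan (exp x))))
    (i2 : Integrable fun x => coshOsc t (arsinhWeight ((τ' - τ) / 2)) (sin (arctan (exp x))) *
      (coshPow ((1 - τ - τ') / 2) x * φ (2 * arctan (exp x)))) :
    Ffun τ τ' (Complex.I * t) n φ =
      2 * (1 / π * Complex.exp (Complex.I * t / 2 * (log 2 : ℝ))) *
      ((∫ x, Complex.exp (Complex.I * (gdPhase n (-(t / 2)) x : ℂ)) *
          (coshOsc t (arsinhWeight ((τ' - τ) / 2)) (cos (arctan (exp x))) *
            (coshPow ((1 - τ - τ') / 2) x * φ (2 * arctan (exp x))))) +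
        ∫ x, Complex.exp (Complex.I * (gdPhase n (t / 2) x : ℂ)) *
          (coshOsc t (arsinhWeight ((τ' - τ) / 2)) (sin (arctan (exp x))) *
            (coshPow ((1 - τ - τ') / 2) x * φ (2 * arctan (exp x))))) := by
  have cph : ∀ κ, Continuous (gdPhase n κ) := fun κ =>
    continuous_iff_continuousAt.2 fun x => (hasDerivAt_gdPhase n κ x).continuousAt
  have j : ∀ (κ : ℝ) {b : ℝ → ℂ}, Integrable b →
      Integrable fun x => Complex.exp (Complex.I * (gdPhase n κ x : ℂ)) * b x := by
    intro κ b hb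
    have := cph κ
    refine hb.bdd_mul (c := 1) (Continuous.aestronglyMeasurable (by fun_prop))
      (Filter.Eventually.of_forall fun x => ?_)
    simp [Complex.norm_exp]
  have hd : ∀ x ∈ Set.univ, HasDerivWithinAt (fun x => 2 * arctan (exp x)) _ Set.univ x :=
    fun x _ => (hasDerivAt_two_mul_arctan_exp x).hasDerivWithinAt
  have hinj : Set.InjOn (fun x => 2 * arctan (exp x)) Set.univ :=
    injective_two_mul_arctan_exp.injOn
  have hper : Function.Periodic (fun c : ℝ => lker τ τ' (Complex.I * t) c *
      Complex.exp (Complex.I * (n : ℂ) * (c : ℂ)) * φ c) π := by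
    intro c
    obtain ⟨k, rfl⟩ := hn
    have : Complex.exp (Complex.I * ((k + k : ℤ) : ℂ) * ((c + π : ℝ) : ℂ)) =
        Complex.exp (Complex.I * ((k + k : ℤ) : ℂ) * (c : ℂ)) := by
      rw [Complex.exp_eq_exp_iff_exists_int]
      exact ⟨k, by push_cast; ring⟩
    simp only [this, hφ c, periodic_lker τ τ' _ c]
  have hint : IntervalIntegrable (fun c : ℝ => lker τ τ' (Complex.I * t) c *
      Complex.exp (Complex.I * (n : ℂ) * (c : ℂ)) * φ c) volume 0 π := by
    rw [intervalIntegrable_iff_integrableOn_Ioo_of_le pi_pos.le, ← image_two_mul_arctan_exp,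
      integrableOn_image_iff_integrableOn_abs_deriv_smul MeasurableSet.univ hd hinj]
    simp only [outer_pullback hτ hτ', integrableOn_univ]
    exact ((j _ i1).add (j _ i2)).const_mul _
  rw [← zero_add π] at hint
  rw [Ffun, integral_zero_two_pi_of_periodic hper hint, zero_add,
    intervalIntegral.integral_of_le pi_pos.le, integral_Ioc_eq_integral_Ioo,
    ← image_two_mul_arctan_exp,
    integral_image_eq_integral_abs_deriv_smul MeasurableSet.univ hd hinj]
  simp only [outer_pullback hτ hτ', setIntegral_univ]
  rw [integral_const_mul, integral_add (j _ i1) (j _ i2)]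
  ring

theorem Cnorm_nonneg (N : ℕ) (φ : ℝ → ℂ) : 0 ≤ Cnorm N φ :=
  Real.iSup_nonneg fun _ => Real.iSup_nonneg fun _ => norm_nonneg _

theorem bddAbove_range_norm_of_periodic {f : ℝ → ℂ} (hc : Continuous f)
    (hf : Function.Periodic f π) : BddAbove (Set.range fun x => ‖f x‖) := by
  obtain ⟨M, hM⟩ := (isCompact_Icc (a := (0 : ℝ)) (b := π)).bddAbove_image hc.norm.continuousOn
  refine ⟨M, ?_⟩
  rintro _ ⟨x, rfl⟩
  obtain ⟨y, hy, e⟩ := hf.exists_mem_Ico₀ pi_pos x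
  dsimp only
  rw [e]
  exact hM ⟨y, ⟨hy.1, hy.2.le⟩, rfl⟩

theorem norm_iteratedDeriv_le_Cnorm {φ : ℝ → ℂ} (hs : ContDiff ℝ (⊤ : ℕ∞) φ)
    (hφ : Function.Periodic φ π) {N m : ℕ} (hm : m ≤ N) (x : ℝ) :
    ‖iteratedDeriv m φ x‖ ≤ Cnorm N φ := by
  have h : ∀ k : ℕ, BddAbove (Set.range fun x => ‖iteratedDeriv k φ x‖) := fun k => by
    refine bddAbove_range_norm_of_periodic (hs.continuous_iteratedDeriv k (by exact_mod_cast le_top))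
      fun y => ?_
    have e : (fun z => φ (z + π)) = φ := funext hφ
    have h2 := iteratedDeriv_comp_add_const k φ π
    rw [e] at h2
    exact (congrFun h2 y).symm
  exact le_ciSup_of_le (Set.finite_range _).bddAbove ⟨m, by omega⟩ (le_ciSup (h m) x)

theorem abs_two_mul_arctan_exp_sub_le (x : ℝ) :
    |2 * arctan (exp x) - π / 2| ≤ 2 * (|sinh x| / cosh x) := by
  have h1 := arctan_pos.2 (exp_pos x)
  have h2 := arctan_lt_pi_div_two (exp x)
  have h := mul_abs_le_abs_sin (x := 2 * arctan (exp x) - π / 2)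
    (abs_le.2 ⟨by linarith, by linarith⟩)
  have e : sin (2 * arctan (exp x) - π / 2) = sinh x / cosh x := by
    rw [sin_sub_pi_div_two, cos_two_mul, cos_sq_arctan, sinh_eq, cosh_eq, exp_neg]
    have := exp_pos x
    field_simp
    ring
  rw [e, abs_div, abs_of_pos (cosh_pos x)] at h
  have hpi := pi_lt_four
  have hpi0 := pi_pos
  generalize |sinh x| / cosh x = T at h
  have h4 : 1 / 2 * |2 * arctan (exp x) - π / 2| ≤ 2 / π * |2 * arctan (exp x) - π / 2| := by
    refine mul_le_mul_of_nonneg_right ?_ (abs_nonneg _)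
    rw [div_le_div_iff₀ two_pos hpi0]
    linarith
  linarith

theorem norm_sub_comp_arctan_exp_le {φ : ℝ → ℂ} {M : ℝ} (hφ : Differentiable ℝ φ)
    (hM : ∀ x, ‖deriv φ x‖ ≤ M) (x : ℝ) :
    ‖φ (2 * arctan (exp x)) - φ (π / 2)‖ ≤ 2 * M * (|sinh x| / cosh x) := by
  have hM0 : 0 ≤ M := (norm_nonneg _).trans (hM 0)
  have h := convex_univ.norm_image_sub_le_of_norm_deriv_le (𝕜 := ℝ) (f := φ)
    (x := π / 2) (y := 2 * arctan (exp x)) (fun y _ => hφ y) (fun y _ => hM y) trivial trivial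
  calc _ ≤ _ := h
    _ ≤ M * (2 * (|sinh x| / cosh x)) := by
      gcongr
      exact abs_two_mul_arctan_exp_sub_le x
    _ = _ := by ring

theorem hasDerivAt_comp_arctan_exp {φ : ℝ → ℂ} (hφ : Differentiable ℝ φ) (x : ℝ) :
    HasDerivAt (fun x => φ (2 * arctan (exp x)))
      ((cosh x)⁻¹ • deriv φ (2 * arctan (exp x))) x :=
  (hφ _).hasDerivAt.scomp x (hasDerivAt_two_mul_arctan_exp x)

/-- A bounded profile with bounded derivative. -/
structure BoundedProfile (N N' : ℝ → ℂ) (B : ℝ) : Prop where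
  hasDerivAt : ∀ x, HasDerivAt N (N' x) x
  bound : ∀ x, ‖N x‖ ≤ B
  bound_deriv : ∀ x, ‖N' x‖ ≤ B

theorem boundedProfile_cos {δ : ℂ} (hδ : δ.re = 0) {t : ℝ} (ht : 1 ≤ t) :
    BoundedProfile (fun x => coshOsc t (arsinhWeight δ) (cos (arctan (exp x))))
      (fun x => (-(sin (arctan (exp x)) ^ 2)) •
        coshOsc t (fun z => z • arsinhWeightDeriv δ z) (cos (arctan (exp x))))
      (11 * π * weightConst δ / √t) where
  hasDerivAt x := hasDerivAt_coshOsc_comp hδ (σ := fun x => cos (arctan (exp x))) (cos_arctan_pos _)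
    (cos_arctan_exp_lt_one x) (hasDerivAt_cos_arctan_exp x)
  bound x := norm_coshOsc_arsinhWeight_le hδ ht (cos_arctan_pos _) (cos_le_one _)
  bound_deriv x := norm_smul_coshOsc_le hδ ht (cos_arctan_pos _) (cos_le_one _)
    (by rw [abs_neg, abs_of_nonneg (sq_nonneg _)]; exact sin_sq_le_one _)

theorem boundedProfile_sin {δ : ℂ} (hδ : δ.re = 0) {t : ℝ} (ht : 1 ≤ t) :
    BoundedProfile (fun x => coshOsc t (arsinhWeight δ) (sin (arctan (exp x))))
      (fun x => (cos (arctan (exp x)) ^ 2) •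
        coshOsc t (fun z => z • arsinhWeightDeriv δ z) (sin (arctan (exp x))))
      (11 * π * weightConst δ / √t) where
  hasDerivAt x := hasDerivAt_coshOsc_comp hδ (σ := fun x => sin (arctan (exp x)))
    (sin_arctan_exp_pos x) (sin_arctan_exp_lt_one x) (hasDerivAt_sin_arctan_exp x)
  bound x := norm_coshOsc_arsinhWeight_le hδ ht (sin_arctan_exp_pos x) (sin_le_one _)
  bound_deriv x := norm_smul_coshOsc_le hδ ht (sin_arctan_exp_pos x) (sin_le_one _)
    (by rw [abs_of_nonneg (sq_nonneg _)]; exact cos_sq_le_one _)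

section Amplitude

variable {N N' ψ ψ' : ℝ → ℂ} {B : ℝ} {z : ℂ}

theorem BoundedProfile.nonneg (h : BoundedProfile N N' B) : 0 ≤ B :=
  (norm_nonneg _).trans (h.bound 0)

theorem BoundedProfile.hasDerivAt_amplitude (h : BoundedProfile N N' B)
    (hψ : ∀ x, HasDerivAt ψ (ψ' x) x) (x : ℝ) :
    HasDerivAt (fun x => N x * (coshPow z x * ψ x))
      (N' x * (coshPow z x * ψ x) +
        N x * (coshPow z x * (z * ((-(sinh x / cosh x) : ℝ) : ℂ)) * ψ x + coshPow z x * ψ' x)) x :=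
  (h.hasDerivAt x).mul ((hasDerivAt_coshPow z x).mul (hψ x))

theorem BoundedProfile.norm_amplitude_le (h : BoundedProfile N N' B) (hz : z.re = 1 / 2)
    (x : ℝ) : ‖N x * (coshPow z x * ψ x)‖ ≤ B * √(cosh x)⁻¹ * ‖ψ x‖ := by
  rw [norm_mul, norm_mul, norm_coshPow hz, ← mul_assoc]
  have := h.bound x
  gcongr

theorem BoundedProfile.norm_amplitude_deriv_le (h : BoundedProfile N N' B) (hz : z.re = 1 / 2)
    (x : ℝ) : ‖N' x * (coshPow z x * ψ x) + N x *
      (coshPow z x * (z * ((-(sinh x / cosh x) : ℝ) : ℂ)) * ψ x + coshPow z x * ψ' x)‖ ≤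
      B * √(cosh x)⁻¹ * ((1 + ‖z‖) * ‖ψ x‖ + ‖ψ' x‖) := by
  have hB := h.nonneg
  have h1 := h.bound x
  have h2 := h.bound_deriv x
  have h3 := norm_coshPow_deriv_le hz x
  refine (norm_add_le _ _).trans ?_
  rw [norm_mul, norm_mul, norm_mul (N x), norm_coshPow hz]
  calc _ ≤ B * (√(cosh x)⁻¹ * ‖ψ x‖) +
        B * ((‖z‖ * √(cosh x)⁻¹) * ‖ψ x‖ + √(cosh x)⁻¹ * ‖ψ' x‖) := by
        gcongr
        refine (norm_add_le _ _).trans ?_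
        rw [norm_mul _ (ψ x), norm_mul _ (ψ' x), norm_coshPow hz]
        gcongr
    _ = _ := by ring

theorem BoundedProfile.integrable_amplitude (h : BoundedProfile N N' B) (hz : z.re = 1 / 2)
    (hψ : ∀ x, HasDerivAt ψ (ψ' x) x) {M : ℝ} (hM : ∀ x, ‖ψ x‖ ≤ M) :
    Integrable fun x => N x * (coshPow z x * ψ x) := by
  have hB := h.nonneg
  have hc : Continuous fun x => N x * (coshPow z x * ψ x) :=
    continuous_iff_continuousAt.2 fun x => (h.hasDerivAt_amplitude hψ x).continuousAt
  refine (integrable_sqrt_inv_cosh.1.const_mul (B * M)).mono' hc.aestronglyMeasurable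
    (Filter.Eventually.of_forall fun x => (h.norm_amplitude_le hz x).trans ?_)
  have := hM x
  calc _ ≤ B * √(cosh x)⁻¹ * M := by gcongr
    _ = _ := by ring

theorem BoundedProfile.norm_integral_one_le (h : BoundedProfile N N' B) (hz : z.re = 1 / 2)
    {n κ m : ℝ} (hm : 1 ≤ m) (hn : m ^ 3 < 4 * n) (hκ : |κ| = m ^ 3 / 2) :
    ‖∫ x, Complex.exp (Complex.I * (gdPhase n κ x : ℂ)) * (N x * (coshPow z x * 1))‖ ≤
      300 * (B * (1 + ‖z‖)) / m := by
  have hB := h.nonneg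
  refine norm_integral_gdPhase_le_airy hm hn hκ
    (h.hasDerivAt_amplitude (ψ := fun _ => 1) fun x => hasDerivAt_const x 1)
    (fun x => (h.norm_amplitude_le (ψ := fun _ => 1) hz x).trans ?_)
    fun x => (h.norm_amplitude_deriv_le (ψ := fun _ => 1) (ψ' := fun _ => 0) hz x).trans ?_
  · rw [norm_one, mul_one, mul_right_comm]
    refine le_mul_of_one_le_right (by positivity) (by linarith [norm_nonneg z])
  · rw [norm_one, norm_zero]
    exact le_of_eq (by ring)

theorem BoundedProfile.norm_integral_sub_le (h : BoundedProfile N N' B) (hz : z.re = 1 / 2)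
    {n κ t M : ℝ} (ht : 1 ≤ t) (hn : t < 4 * n) (hκ : |κ| = t / 2) {φ : ℝ → ℂ}
    (hφ : Differentiable ℝ φ) (hM : ∀ x, ‖deriv φ x‖ ≤ M) :
    ‖∫ x, Complex.exp (Complex.I * (gdPhase n κ x : ℂ)) *
        (N x * (coshPow z x * (φ (2 * arctan (exp x)) - φ (π / 2))))‖ ≤
      300 * (B * M * (3 + 2 * ‖z‖)) / √n := by
  have hB := h.nonneg
  have hM0 : 0 ≤ M := (norm_nonneg _).trans (hM 0)
  refine norm_integral_gdPhase_le_of_vanishing ht hn hκ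
    (h.hasDerivAt_amplitude (ψ := fun x => φ (2 * arctan (exp x)) - φ (π / 2))
      fun x => (hasDerivAt_comp_arctan_exp hφ x).sub_const (φ (π / 2)))
    (fun x => (h.norm_amplitude_le (ψ := fun x => φ (2 * arctan (exp x)) - φ (π / 2)) hz x).trans ?_)
    fun x => (h.norm_amplitude_deriv_le
      (ψ := fun x => φ (2 * arctan (exp x)) - φ (π / 2))
      (ψ' := fun x => (cosh x)⁻¹ • deriv φ (2 * arctan (exp x))) hz x).trans ?_
  · have h1 := norm_sub_comp_arctan_exp_le hφ hM x
    have hT : 0 ≤ |sinh x| / cosh x := div_nonneg (abs_nonneg _) (cosh_pos x).le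
    calc _ ≤ B * √(cosh x)⁻¹ * (2 * M * (|sinh x| / cosh x)) := by gcongr
      _ = B * M * 2 * (√(cosh x)⁻¹ * (|sinh x| / cosh x)) := by ring
      _ ≤ _ := by gcongr; linarith [norm_nonneg z]
  · have h1 := norm_sub_comp_arctan_exp_le hφ hM x
    have h2 : ‖φ (2 * arctan (exp x)) - φ (π / 2)‖ ≤ 2 * M * 1 :=
      h1.trans (mul_le_mul_of_nonneg_left (abs_sinh_div_cosh_le x) (by positivity))
    have h3 : ‖(cosh x)⁻¹ • deriv φ (2 * arctan (exp x))‖ ≤ 1 * M := by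
      rw [norm_smul, norm_of_nonneg (inv_nonneg.2 (cosh_pos x).le)]
      gcongr
      · exact inv_le_one_of_one_le₀ (one_le_cosh x)
      · exact hM _
    calc _ ≤ B * √(cosh x)⁻¹ * ((1 + ‖z‖) * (2 * M * 1) + 1 * M) := by gcongr
      _ = _ := by ring

theorem BoundedProfile.integral_sub_mul (h : BoundedProfile N N' B) (hz : z.re = 1 / 2)
    (n κ : ℝ) {φ : ℝ → ℂ} {M : ℝ} (hφ : Differentiable ℝ φ) (hM : ∀ x, ‖φ x‖ ≤ M) :
    (∫ x, Complex.exp (Complex.I * (gdPhase n κ x : ℂ)) *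
        (N x * (coshPow z x * φ (2 * arctan (exp x))))) -
      (∫ x, Complex.exp (Complex.I * (gdPhase n κ x : ℂ)) * (N x * (coshPow z x * 1))) *
        φ (π / 2) =
    ∫ x, Complex.exp (Complex.I * (gdPhase n κ x : ℂ)) *
        (N x * (coshPow z x * (φ (2 * arctan (exp x)) - φ (π / 2)))) := by
  have cph : Continuous (gdPhase n κ) :=
    continuous_iff_continuousAt.2 fun x => (hasDerivAt_gdPhase n κ x).continuousAt
  have j : ∀ {b : ℝ → ℂ}, Integrable b →
      Integrable fun x => Complex.exp (Complex.I * (gdPhase n κ x : ℂ)) * b x := by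
    intro b hb
    refine hb.bdd_mul (c := 1) (Continuous.aestronglyMeasurable (by fun_prop))
      (Filter.Eventually.of_forall fun x => ?_)
    simp [Complex.norm_exp]
  have i1 := j (h.integrable_amplitude hz (hasDerivAt_comp_arctan_exp hφ) fun x => hM _)
  have i2 := j (h.integrable_amplitude hz (ψ := fun _ => 1) (fun x => hasDerivAt_const x 1)
    (M := 1) fun x => by simp)
  rw [← integral_mul_const, ← integral_sub i1 (i2.mul_const _)]
  congr 1
  ext x
  ring

end Amplitude

theorem norm_outer_factor (t : ℝ) :
    ‖2 * (1 / (π : ℂ) * Complex.exp (Complex.I * t / 2 * (log 2 : ℝ)))‖ = 2 / π := by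
  have h : ‖Complex.exp (Complex.I * t / 2 * (log 2 : ℝ))‖ = 1 := by
    have e : Complex.I * t / 2 * (log 2 : ℝ) = ((t / 2 * log 2 : ℝ) : ℂ) * Complex.I := by
      push_cast; ring
    rw [e, Complex.norm_exp_ofReal_mul_I]
  rw [norm_mul, norm_mul, h, norm_div, Complex.norm_real, norm_of_nonneg pi_pos.le]
  simp
  ring

/-- For `𝒮 ≤ t < 4n` there is `A(λ,n)` with `|A(λ,n)| ≤ C t^{-5/6}` such that
`|F_{it,n}(φ) - A(λ,n) φ(π/2)| ≤ C ‖φ‖_{C²} t^{-1/2} (1+n)^{-1/2} + C ‖φ‖_{C³} t^{-3/2}`. -/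
theorem stmt_10 (τ τ' : ℂ) (hτ : τ.re = 0) (hτ' : τ'.re = 0) :
    ∃ C : ℝ, 0 < C ∧
      ∀ n : ℤ, 0 ≤ n → Even n →
        ∀ t : ℝ, 2 * (‖τ‖ + ‖τ'‖) + 1 ≤ t → t < 4 * (n : ℝ) →
          ∃ A : ℂ, ‖A‖ ≤ C * t ^ (-(5 / 6) : ℝ) ∧
            ∀ φ : ℝ → ℂ, ContDiff ℝ (⊤ : ℕ∞) φ → (∀ x : ℝ, φ (x + π) = φ x) →
              ‖Ffun τ τ' (Complex.I * (t : ℂ)) n φ - A * φ (π / 2)‖ ≤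
                C * Cnorm 2 φ * t ^ (-(1 / 2) : ℝ) * (1 + (n : ℝ)) ^ (-(1 / 2) : ℝ) +
                  C * Cnorm 3 φ * t ^ (-(3 / 2) : ℝ) := by
  have hδ : ((τ' - τ) / 2).re = 0 := by simp [hτ, hτ']
  have hz : ((1 - τ - τ') / 2).re = 1 / 2 := by simp [hτ, hτ']
  have hw := weightConst_pos ((τ' - τ) / 2)
  set w := weightConst ((τ' - τ) / 2)
  set z := (1 - τ - τ') / 2
  refine ⟨26400 * w * (3 + 2 * ‖z‖), by positivity, fun n _ hn t ht htn => ?_⟩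
  have ht1 : 1 ≤ t := by linarith [norm_nonneg τ, norm_nonneg τ']
  have ht0 : 0 < t := by linarith
  have hn1 : (1 : ℝ) ≤ n := by
    have : (0 : ℝ) < n := by linarith
    exact_mod_cast this
  have hk1 : |(-(t / 2))| = t / 2 := by rw [abs_neg, abs_of_pos (by positivity)]
  have hk2 : |t / 2| = t / 2 := abs_of_pos (by positivity)
  have P1 := boundedProfile_cos hδ ht1
  have P2 := boundedProfile_sin hδ ht1
  refine ⟨2 * (1 / π * Complex.exp (Complex.I * t / 2 * (log 2 : ℝ))) *
    ((∫ x, Complex.exp (Complex.I * (gdPhase n (-(t / 2)) x : ℂ)) *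
        (coshOsc t (arsinhWeight ((τ' - τ) / 2)) (cos (arctan (exp x))) * (coshPow z x * 1))) +
      ∫ x, Complex.exp (Complex.I * (gdPhase n (t / 2) x : ℂ)) *
        (coshOsc t (arsinhWeight ((τ' - τ) / 2)) (sin (arctan (exp x))) * (coshPow z x * 1))),
    ?_, fun φ hs hφ => ?_⟩
  · have hm1 : 1 ≤ t ^ (1 / 3 : ℝ) := one_le_rpow ht1 (by norm_num)
    have hm3 : (t ^ (1 / 3 : ℝ)) ^ 3 = t := by
      rw [← rpow_natCast, ← rpow_mul ht0.le]; norm_num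
    have b1 := P1.norm_integral_one_le hz (κ := -(t / 2)) hm1 (by rwa [hm3]) (by rw [hm3]; exact hk1)
    have b2 := P2.norm_integral_one_le hz (κ := t / 2) hm1 (by rwa [hm3]) (by rw [hm3]; exact hk2)
    have ht56 : t ^ (-(5 / 6) : ℝ) = (√t)⁻¹ * (t ^ (1 / 3 : ℝ))⁻¹ := by
      rw [sqrt_eq_rpow, ← rpow_neg ht0.le, ← rpow_neg ht0.le, ← rpow_add ht0]
      norm_num
    rw [norm_mul, norm_outer_factor, ht56]
    have hpi := pi_pos
    have hst := sqrt_pos.2 ht0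
    calc _ ≤ 2 / π * (300 * (11 * π * w / √t * (1 + ‖z‖)) / t ^ (1 / 3 : ℝ) +
          300 * (11 * π * w / √t * (1 + ‖z‖)) / t ^ (1 / 3 : ℝ)) := by
          gcongr
          exact (norm_add_le _ _).trans (add_le_add b1 b2)
      _ = 13200 * w * (1 + ‖z‖) * ((√t)⁻¹ * (t ^ (1 / 3 : ℝ))⁻¹) := by
          field_simp; norm_num
      _ ≤ _ := by
          gcongr ?_ * _
          nlinarith [mul_nonneg hw.le (norm_nonneg z)]
  · have hd : Differentiable ℝ φ := hs.differentiable (by simp)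
    have hM0 : ∀ x, ‖φ x‖ ≤ Cnorm 2 φ := fun x => by
      simpa using norm_iteratedDeriv_le_Cnorm hs hφ (N := 2) (m := 0) (by norm_num) x
    have hM1 : ∀ x, ‖deriv φ x‖ ≤ Cnorm 2 φ := fun x => by
      simpa using norm_iteratedDeriv_le_Cnorm hs hφ (N := 2) (m := 1) (by norm_num) x
    have hC2 := Cnorm_nonneg 2 φ
    have hC3 := Cnorm_nonneg 3 φ
    have b1 := P1.norm_integral_sub_le hz ht1 htn hk1 hd hM1
    have b2 := P2.norm_integral_sub_le hz ht1 htn hk2 hd hM1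
    rw [Ffun_eq hτ hτ' hn hφ
      (P1.integrable_amplitude hz (hasDerivAt_comp_arctan_exp hd) fun x => hM0 _)
      (P2.integrable_amplitude hz (hasDerivAt_comp_arctan_exp hd) fun x => hM0 _),
      mul_assoc (2 * _), ← mul_sub, add_mul, add_sub_add_comm, P1.integral_sub_mul hz _ _ hd hM0,
      P2.integral_sub_mul hz _ _ hd hM0, norm_mul, norm_outer_factor]
    have ht12 : t ^ (-(1 / 2) : ℝ) = (√t)⁻¹ := by rw [sqrt_eq_rpow, ← rpow_neg ht0.le]
    have hn12 : (1 + (n : ℝ)) ^ (-(1 / 2) : ℝ) = (√(1 + n))⁻¹ := by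
      rw [sqrt_eq_rpow, ← rpow_neg (by positivity)]
    have hpi := pi_pos
    have hst := sqrt_pos.2 ht0
    have hsn : 0 < √(n : ℝ) := sqrt_pos.2 (by linarith)
    have hnn : (√(n : ℝ))⁻¹ ≤ 2 * (√(1 + n))⁻¹ := by
      rw [← div_eq_mul_inv, inv_le_iff_one_le_mul₀ hsn, div_mul_eq_mul_div,
        le_div_iff₀ (sqrt_pos.2 (by positivity)), one_mul, sqrt_le_left (by positivity), mul_pow,
        sq_sqrt (by linarith)]
      linarith
    rw [ht12, hn12]
    have h3 : 0 ≤ 26400 * w * (3 + 2 * ‖z‖) * Cnorm 3 φ * t ^ (-(3 / 2) : ℝ) := by positivity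
    refine le_trans ?_ (le_add_of_nonneg_right h3)
    calc _ ≤ 2 / π * (300 * (11 * π * w / √t * Cnorm 2 φ * (3 + 2 * ‖z‖)) / √n +
          300 * (11 * π * w / √t * Cnorm 2 φ * (3 + 2 * ‖z‖)) / √n) := by
          gcongr
          exact (norm_add_le _ _).trans (add_le_add b1 b2)
      _ = 13200 * w * (3 + 2 * ‖z‖) * Cnorm 2 φ * (√t)⁻¹ * (√(n : ℝ))⁻¹ := by
          field_simp; ring
      _ ≤ 13200 * w * (3 + 2 * ‖z‖) * Cnorm 2 φ * (√t)⁻¹ * (2 * (√(1 + n))⁻¹) := by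
          gcongr
      _ = _ := by ring
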